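/- arXiv:2005.14285 — 3 statements merged into one kernel-verified Lean document; each statement's English description precedes it below -/
import Mathlib

section
/- Let P ⊆ ℝ³ be a full-dimensional strictly bipartite convex polytope. Then the origin lies in the topological interior of P. -/
open Set Pointwise

noncomputable section

/-- Euclidean space `ℝ^d`. -/
abbrev Euc (d : ℕ) := EuclideanSpace ℝ (Fin d)

/-- A convex polytope: the convex hull of a finite set of points. -/
def IsPolytope {d : ℕ} (P : Set (Euc d)) : Prop :=
  ∃ S : Finset (Euc d), P = convexHull ℝ (S : Set (Euc d))

/-- `P` is full-dimensional: its affine span is all of `ℝ^d`. -/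
def FullDim {d : ℕ} (P : Set (Euc d)) : Prop :=
  affineSpan ℝ P = ⊤

/-- `[v,w]` is an edge of `P`: an exposed face of `P` which is a segment with `v ≠ w`. -/
def IsEdge {d : ℕ} (P : Set (Euc d)) (v w : Euc d) : Prop :=
  v ≠ w ∧ IsExposed ℝ P (segment ℝ v w)

/-- `e` is an edge of `P`, as a set. -/
def IsEdgeSet {d : ℕ} (P e : Set (Euc d)) : Prop :=
  ∃ v w : Euc d, IsEdge P v w ∧ e = segment ℝ v w

/-- `T` is a symmetry of `P`: a linear isometry mapping `P` onto itself. -/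
def IsAut {d : ℕ} (P : Set (Euc d)) (T : Euc d ≃ₗᵢ[ℝ] Euc d) : Prop :=
  T '' P = P

/-- `P` is vertex-transitive: any vertex (extreme point) can be mapped onto any
other by a symmetry of `P`. -/
def VertexTransitive {d : ℕ} (P : Set (Euc d)) : Prop :=
  ∀ v ∈ Set.extremePoints ℝ P, ∀ w ∈ Set.extremePoints ℝ P,
    ∃ T : Euc d ≃ₗᵢ[ℝ] Euc d, IsAut P T ∧ T v = w

/-- `P` is edge-transitive: any edge can be mapped onto any other by a symmetry of `P`. -/
def EdgeTransitive {d : ℕ} (P : Set (Euc d)) : Prop :=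
  ∀ e e' : Set (Euc d), IsEdgeSet P e → IsEdgeSet P e' →
    ∃ T : Euc d ≃ₗᵢ[ℝ] Euc d, IsAut P T ∧ T '' e = e'

/-- `P` is bipartite with vertex partition `V1, V2`, radii `r1 ≤ r2` and edge length `ℓ`:
all edges have length `ℓ`, every edge joins `V1` to `V2`, where `V1 ⊔ V2` is a partition of
the vertex set, and vertices in `Vᵢ` have norm `rᵢ`. -/
def IsBipartiteWith {d : ℕ} (P V1 V2 : Set (Euc d)) (r1 r2 ℓ : ℝ) : Prop :=
  (0 < ℓ) ∧ (∀ v w : Euc d, IsEdge P v w → ‖v - w‖ = ℓ) ∧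
  (V1 ∪ V2 = Set.extremePoints ℝ P) ∧ Disjoint V1 V2 ∧
  (∀ v w : Euc d, IsEdge P v w → (v ∈ V1 ∧ w ∈ V2) ∨ (v ∈ V2 ∧ w ∈ V1)) ∧
  (0 < r1) ∧ (r1 ≤ r2) ∧ (∀ v ∈ V1, ‖v‖ = r1) ∧ (∀ v ∈ V2, ‖v‖ = r2)

/-- `P` is a bipartite polytope. -/
def IsBipartite {d : ℕ} (P : Set (Euc d)) : Prop :=
  ∃ (V1 V2 : Set (Euc d)) (r1 r2 ℓ : ℝ), IsBipartiteWith P V1 V2 r1 r2 ℓ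

/-- `P` is a strictly bipartite polytope (`r1 < r2`). -/
def IsStrictlyBipartite {d : ℕ} (P : Set (Euc d)) : Prop :=
  ∃ (V1 V2 : Set (Euc d)) (r1 r2 ℓ : ℝ), IsBipartiteWith P V1 V2 r1 r2 ℓ ∧ r1 < r2

lemma exists_strict_separation_of_mem_extremePoints {d : ℕ} {A : Set (Euc d)} (hA : A.Finite)
    {e : Euc d} (he : e ∈ (convexHull ℝ A).extremePoints ℝ) :
    ∃ f : StrongDual ℝ (Euc d), ∀ z ∈ A, z ≠ e → f e < f z := by
  have hmem : e ∉ convexHull ℝ (A \ {e}) := by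
    have h := ((convex_convexHull ℝ A).mem_extremePoints_iff_mem_sdiff_convexHull_sdiff.1 he).2
    exact fun h' => h (convexHull_mono (sdiff_subset_sdiff_left (subset_convexHull ℝ A)) h')
  obtain ⟨f, u, hu, hf⟩ := geometric_hahn_banach_point_closed (convex_convexHull ℝ _)
    ((hA.subset sdiff_subset).isClosed_convexHull ℝ) hmem
  exact ⟨f, fun z hz hne => hu.trans (hf z (subset_convexHull ℝ _ ⟨hz, hne⟩))⟩

lemma isExposed_segment_of_forall_lt {d : ℕ} {A : Set (Euc d)} {v w : Euc d} (hv : v ∈ A)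
    (hw : w ∈ A) (f : StrongDual ℝ (Euc d)) (hvw : f v = f w)
    (hf : ∀ z ∈ A, z ≠ v → z ≠ w → f z < f v) :
    IsExposed ℝ (convexHull ℝ A) (segment ℝ v w) := by
  intro _
  have hle : convexHull ℝ A ⊆ {x | f x ≤ f v} := by
    refine convexHull_min (fun z hz => ?_) (convex_halfSpace_le f.isLinear _)
    by_cases h1 : z = v
    · simp [h1]
    by_cases h2 : z = w
    · simp [h2, hvw]
    exact (hf z hz h1 h2).le
  have heq : ∀ x ∈ segment ℝ v w, f x = f v := by
    rintro x ⟨a, b, ha, hb, hab, rfl⟩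
    simp only [map_add, map_smul, smul_eq_mul, ← hvw]
    rw [← add_mul, hab, one_mul]
  refine ⟨f, Subset.antisymm (fun x hx => ⟨?_, fun y hy => (hle hy).trans (heq x hx).ge⟩) ?_⟩
  · exact segment_subset_convexHull hv hw hx
  rintro x ⟨hx, hmax⟩
  have hxv : f v ≤ f x := hmax v (subset_convexHull ℝ _ hv)
  rcases (A \ {v, w}).eq_empty_or_nonempty with hB | hB
  · rw [sdiff_eq_empty] at hB
    rw [← convexHull_pair]
    exact convexHull_mono hB hx
  have hA : A = {v, w} ∪ (A \ {v, w}) := by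
    rw [union_sdiff_cancel]
    rintro z (rfl | rfl) <;> assumption
  rw [hA, convexHull_union (by simp) hB, mem_convexJoin] at hx
  obtain ⟨p, hp, q, hq, a, b, ha, hb, hab, rfl⟩ := hx
  rw [convexHull_pair] at hp
  have hq' : f q < f v := by
    have : convexHull ℝ (A \ {v, w}) ⊆ {x | f x < f v} := by
      refine convexHull_min (fun z hz => ?_) (convex_halfSpace_lt f.isLinear _)
      simp only [mem_sdiff, mem_insert_iff, mem_singleton_iff, not_or] at hz
      exact hf z hz.1 hz.2.1 hz.2.2
    exact this hq
  have hp' := heq p hp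
  simp only [map_add, map_smul, smul_eq_mul, hp'] at hxv
  have hb0 : b = 0 := by
    have : a = 1 - b := by linarith
    subst this
    nlinarith
  have ha1 : a = 1 := by linarith
  simpa [hb0, ha1] using hp

lemma IsPolytope.finite_extremePoints {d : ℕ} {P : Set (Euc d)} (hP : IsPolytope P) :
    (P.extremePoints ℝ).Finite := by
  obtain ⟨S, rfl⟩ := hP
  exact S.finite_toSet.subset extremePoints_convexHull_subset

lemma IsPolytope.isCompact {d : ℕ} {P : Set (Euc d)} (hP : IsPolytope P) : IsCompact P := by
  obtain ⟨S, rfl⟩ := hP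
  exact S.finite_toSet.isCompact_convexHull ℝ

lemma IsPolytope.convex {d : ℕ} {P : Set (Euc d)} (hP : IsPolytope P) : Convex ℝ P := by
  obtain ⟨S, rfl⟩ := hP
  exact convex_convexHull ℝ _

lemma IsPolytope.convexHull_extremePoints {d : ℕ} {P : Set (Euc d)} (hP : IsPolytope P) :
    convexHull ℝ (P.extremePoints ℝ) = P := by
  rw [← (hP.finite_extremePoints.isClosed_convexHull ℝ).closure_eq,
    closure_convexHull_extremePoints hP.isCompact hP.convex]

/-- A polytope is contained in the cone spanned at a vertex by the edges through it. -/
lemma IsPolytope.sub_mem_hull_edges {d : ℕ} {P : Set (Euc d)} (hP : IsPolytope P) {v x : Euc d}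
    (hv : v ∈ P.extremePoints ℝ) (hx : x ∈ P) :
    x - v ∈ PointedCone.hull ℝ {u | ∃ w, IsEdge P v w ∧ u = w - v} := by
  set X := P.extremePoints ℝ with hX
  have hXfin : X.Finite := hP.finite_extremePoints
  have hPX : convexHull ℝ X = P := hP.convexHull_extremePoints
  set C := PointedCone.hull ℝ {u | ∃ w, IsEdge P v w ∧ u = w - v} with hC
  obtain ⟨φ, hφ⟩ := exists_strict_separation_of_mem_extremePoints hXfin
    (e := v) (by rw [hPX]; exact hv)
  set g : Euc d → Euc d := fun y => (φ (y - v))⁻¹ • (y - v) with hg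
  have hpos : ∀ y ∈ X, y ≠ v → 0 < φ (y - v) := fun y hy hne => by
    rw [map_sub]; linarith [hφ y hy hne]
  have hback : ∀ y ∈ X, y ≠ v → y = v + φ (y - v) • g y := fun y hy hne => by
    simp only [hg, smul_smul]
    rw [mul_inv_cancel₀ (hpos y hy hne).ne', one_smul, add_sub_cancel]
  have hφg : ∀ y ∈ X, y ≠ v → φ (g y) = 1 := fun y hy hne => by
    simp only [hg, map_smul, smul_eq_mul]
    exact inv_mul_cancel₀ (hpos y hy hne).ne'
  have hinj : ∀ y ∈ X, y ≠ v → ∀ z ∈ X, z ≠ v → g y = g z → φ (y - v) ≤ φ (z - v) → y = z := by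
    intro y hy hyv z hz hzv hyz hle
    by_contra hne
    have hlt : φ (y - v) < φ (z - v) := by
      refine lt_of_le_of_ne hle fun h => hne ?_
      rw [hback y hy hyv, hback z hz hzv, hyz, h]
    have hz0 := hpos z hz hzv
    have hy0 := hpos y hy hyv
    refine hyv (mem_extremePoints_iff_left.1 hy |>.2 v hv.1 z hz.1 ?_ |>.symm)
    refine ⟨1 - φ (y - v) / φ (z - v), φ (y - v) / φ (z - v), ?_, by positivity, by ring, ?_⟩
    · rw [sub_pos, div_lt_one hz0]; exact hlt
    · refine Eq.trans ?_ (hback y hy hyv).symm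
      rw [hyz]
      simp only [hg, smul_smul, ← div_eq_mul_inv, sub_smul, one_smul, smul_sub]
      abel
  set Y := g '' (X \ {v}) with hY
  have hYfin : Y.Finite := (hXfin.subset sdiff_subset).image g
  have hYC : Y ⊆ C := by
    have hsub : convexHull ℝ Y ⊆ C := by
      rw [← closure_convexHull_extremePoints (hYfin.isCompact_convexHull ℝ) (convex_convexHull ℝ Y),
        ((hYfin.subset extremePoints_convexHull_subset).isClosed_convexHull ℝ).closure_eq]
      refine convexHull_min (fun e he => ?_) C.convex
      obtain ⟨ψ, hψ⟩ := exists_strict_separation_of_mem_extremePoints hYfin he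
      obtain ⟨w, ⟨hw, hwv⟩, rfl⟩ := extremePoints_convexHull_subset he
      have hwv' : w ≠ v := hwv
      have hw0 := hpos w hw hwv'
      have hedge : IsEdge P v w := by
        refine ⟨hwv'.symm, ?_⟩
        rw [← hPX]
        set f : StrongDual ℝ (Euc d) := ψ (g w) • φ - ψ with hf
        have hfz : ∀ z ∈ X, z ≠ v → f z = f v + φ (z - v) * (ψ (g w) - ψ (g z)) := by
          intro z hz hzv
          have h1 : f z = f (v + φ (z - v) • g z) := by rw [← hback z hz hzv]
          rw [h1, map_add, map_smul, smul_eq_mul]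
          congr 2
          simp [hf, hφg z hz hzv]
        refine isExposed_segment_of_forall_lt hv hw f (by simp [hfz w hw hwv']) ?_
        intro z hz hzv hzw
        have hz0 := hpos z hz hzv
        have hne : g z ≠ g w := fun h => by
          rcases le_total (φ (z - v)) (φ (w - v)) with hle | hle
          · exact hzw (hinj z hz hzv w hw hwv' h hle)
          · exact hzw (hinj w hw hwv' z hz hzv h.symm hle).symm
        have := hψ (g z) ⟨z, ⟨hz, hzv⟩, rfl⟩ hne
        rw [hfz z hz hzv]
        nlinarith
      have hmem : w - v ∈ C := Submodule.subset_span ⟨w, hedge, rfl⟩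
      exact C.smul_mem (inv_nonneg.2 hw0.le) hmem
    exact (subset_convexHull ℝ Y).trans hsub
  have hconv : Convex ℝ {x | x - v ∈ C} := by
    have := C.convex.translate_preimage_left (-v)
    simpa [preimage, neg_add_eq_sub, sub_eq_add_neg] using this
  have hXC : X ⊆ {x | x - v ∈ C} := by
    intro y hy
    by_cases hyv : y = v
    · simp [hyv]
    have h : y - v = φ (y - v) • g y := sub_eq_iff_eq_add'.2 (hback y hy hyv)
    change y - v ∈ C
    rw [h]
    exact C.smul_mem (hpos y hy hyv).le (hYC ⟨y, ⟨hy, hyv⟩, rfl⟩)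
  have := convexHull_min hXC hconv
  rw [hPX] at this
  exact this hx

lemma IsPolytope.apply_nonneg_of_edges {d : ℕ} {P : Set (Euc d)} (hP : IsPolytope P) {v x : Euc d}
    (hv : v ∈ P.extremePoints ℝ) (hx : x ∈ P) (f : StrongDual ℝ (Euc d))
    (hf : ∀ w, IsEdge P v w → 0 ≤ f (w - v)) : 0 ≤ f (x - v) := by
  have h := hP.sub_mem_hull_edges hv hx
  generalize x - v = y at h ⊢
  induction h using Submodule.span_induction with
  | mem u hu => obtain ⟨w, hw, rfl⟩ := hu; exact hf w hw
  | zero => simp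
  | add a b _ _ ha hb => rw [map_add]; exact add_nonneg ha hb
  | smul c a _ ha =>
    rw [show c • a = (c : ℝ) • a from rfl, map_smul]
    exact mul_nonneg c.2 ha

lemma IsPolytope.apply_pos_of_edges {d : ℕ} {P : Set (Euc d)} (hP : IsPolytope P) {v x : Euc d}
    (hv : v ∈ P.extremePoints ℝ) (hx : x ∈ P) (hxv : x ≠ v) (f : StrongDual ℝ (Euc d))
    (hf : ∀ w, IsEdge P v w → 0 < f (w - v)) : 0 < f (x - v) := by
  have h := hP.sub_mem_hull_edges hv hx
  have key : x - v = 0 ∨ 0 < f (x - v) := by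
    generalize x - v = y at h ⊢
    induction h using Submodule.span_induction with
    | mem u hu => obtain ⟨w, hw, rfl⟩ := hu; exact Or.inr (hf w hw)
    | zero => simp
    | add a b _ _ ha hb =>
      rcases ha with rfl | ha
      · simpa using hb
      rcases hb with rfl | hb
      · simpa using Or.inr ha
      · exact Or.inr (by rw [map_add]; exact add_pos ha hb)
    | smul c a _ ha =>
      rcases ha with rfl | ha
      · simp
      rcases eq_or_ne c 0 with rfl | hc
      · simp
      rw [show c • a = (c : ℝ) • a from rfl, map_smul]
      exact Or.inr (mul_pos (lt_of_le_of_ne c.2 fun h => hc (Subtype.ext h.symm)) ha)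
  exact key.resolve_left (sub_ne_zero.2 hxv)

lemma IsPolytope.span_edges_eq_top {d : ℕ} {P : Set (Euc d)} (hP : IsPolytope P)
    (hfull : FullDim P) {v : Euc d} (hv : v ∈ P.extremePoints ℝ) :
    Submodule.span ℝ {u | ∃ w, IsEdge P v w ∧ u = w - v} = ⊤ := by
  have h1 : vectorSpan ℝ P = ⊤ := by
    rw [← direction_affineSpan, hfull, AffineSubspace.direction_top]
  rw [eq_top_iff, ← h1, vectorSpan_eq_span_vsub_set_right ℝ hv.1, Submodule.span_le]
  rintro _ ⟨x, hx, rfl⟩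
  exact PointedCone.hull_le_span ℝ _ (hP.sub_mem_hull_edges hv hx)

/-- Three pairwise obtuse vectors in a plane positively span it. -/
lemma eq_zero_of_pairwise_obtuse {u q₁ q₂ q₃ p : Euc 3} (hu : u ≠ 0)
    (hu₁ : inner ℝ u q₁ = 0) (hu₂ : inner ℝ u q₂ = 0) (hu₃ : inner ℝ u q₃ = 0)
    (hup : inner ℝ u p = 0) (h₁₂ : inner ℝ q₁ q₂ < 0) (h₁₃ : inner ℝ q₁ q₃ < 0)
    (h₂₃ : inner ℝ q₂ q₃ < 0) (hp₁ : inner ℝ p q₁ ≤ 0) (hp₂ : inner ℝ p q₂ ≤ 0)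
    (hp₃ : inner ℝ p q₃ ≤ 0) : p = 0 := by
  have huu : 0 < inner ℝ u u := real_inner_self_pos.2 hu
  have hq₁ : 0 < inner ℝ q₁ q₁ := real_inner_self_pos.2 (by rintro rfl; simp at h₁₂)
  have hq₂ : 0 < inner ℝ q₂ q₂ := real_inner_self_pos.2 (by rintro rfl; simp at h₁₂)
  have hli : LinearIndependent ℝ ![u, q₁, q₂] := by
    rw [Fintype.linearIndependent_iff]
    intro g hg
    simp only [Fin.sum_univ_three, Matrix.cons_val_zero, Matrix.cons_val_one,
      Matrix.cons_val] at hg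
    have e0 := congrArg (fun y => inner ℝ u y) hg
    have e1 := congrArg (fun y => inner ℝ q₁ y) hg
    have e3 := congrArg (fun y => inner ℝ q₃ y) hg
    simp only [inner_add_right, inner_smul_right, inner_zero_right, hu₁, hu₂,
      real_inner_comm u q₁, real_inner_comm u q₃, real_inner_comm q₁ q₃, real_inner_comm q₂ q₃,
      hu₃] at e0 e1 e3
    have g0 : g 0 = 0 := by
      have : g 0 * inner ℝ u u = 0 := by linarith
      exact (mul_eq_zero.1 this).resolve_right huu.ne'
    have g1 : g 1 = 0 := by
      rcases lt_trichotomy (g 1) 0 with h | h | h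
      · have : g 2 < 0 := by
          by_contra! h'
          nlinarith
        nlinarith
      · exact h
      · have : 0 < g 2 := by
          by_contra! h'
          nlinarith
        nlinarith
    have g2 : g 2 = 0 := by
      rw [g1] at e1
      have : g 2 * inner ℝ q₁ q₂ = 0 := by linarith
      exact (mul_eq_zero.1 this).resolve_right h₁₂.ne
    intro i
    fin_cases i <;> assumption
  have hspan : ∀ y : Euc 3, ∃ a b c : ℝ, y = a • u + b • q₁ + c • q₂ := by
    have htop := hli.span_eq_top_of_card_eq_finrank' (by simp)
    intro y
    have hy : y ∈ Submodule.span ℝ (range ![u, q₁, q₂]) := by rw [htop]; trivial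
    obtain ⟨c, hc⟩ := (Submodule.mem_span_range_iff_exists_fun ℝ).1 hy
    refine ⟨c 0, c 1, c 2, ?_⟩
    rw [← hc]
    simp [Fin.sum_univ_three]
  obtain ⟨a, s, t, h₃⟩ := hspan q₃
  have ha : a = 0 := by
    rw [h₃] at hu₃
    simp only [inner_add_right, inner_smul_right, hu₁, hu₂] at hu₃
    have : a * inner ℝ u u = 0 := by linarith
    exact (mul_eq_zero.1 this).resolve_right huu.ne'
  simp only [h₃, ha, zero_smul, zero_add, inner_add_right, inner_smul_right,
    real_inner_comm q₁ q₂] at h₁₃ h₂₃ hp₃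
  have hst : s < 0 ∧ t < 0 := by
    have hcs : inner ℝ q₁ q₂ * inner ℝ q₁ q₂ ≤ inner ℝ q₁ q₁ * inner ℝ q₂ q₂ :=
      real_inner_mul_inner_self_le q₁ q₂
    constructor
    · by_contra! hs
      nlinarith [mul_pos hq₁ hq₂, mul_neg_of_neg_of_pos h₁₃ hq₂, mul_pos_of_neg_of_neg h₂₃ h₁₂,
        mul_nonneg hs (sub_nonneg.2 hcs)]
    · by_contra! ht
      nlinarith [mul_pos hq₁ hq₂, mul_neg_of_neg_of_pos h₂₃ hq₁, mul_pos_of_neg_of_neg h₁₃ h₁₂,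
        mul_nonneg ht (sub_nonneg.2 hcs)]
  have z₁ : inner ℝ p q₁ = 0 := by nlinarith [hst.1, hst.2]
  have z₂ : inner ℝ p q₂ = 0 := by nlinarith [hst.1, hst.2]
  obtain ⟨a, b, c, hp⟩ := hspan p
  rw [← inner_self_eq_zero (𝕜 := ℝ)]
  nth_rewrite 2 [hp]
  simp only [inner_add_right, inner_smul_right, real_inner_comm u p, hup, z₁, z₂]
  ring

lemma IsPolytope.extremePoints_nonempty {d : ℕ} {P : Set (Euc d)} (hP : IsPolytope P)
    (hfull : FullDim P) : (P.extremePoints ℝ).Nonempty := by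
  refine hP.isCompact.extremePoints_nonempty ?_
  rw [← affineSpan_nonempty ℝ, hfull]
  exact ⟨0, trivial⟩

lemma IsPolytope.exists_isEdge {d : ℕ} {P : Set (Euc d)} (hP : IsPolytope P)
    (hfull : FullDim P) (hd : 0 < d) {v : Euc d} (hv : v ∈ P.extremePoints ℝ) : ∃ w, IsEdge P v w := by
  by_contra! hno
  have hspan := hP.span_edges_eq_top hfull hv
  simp only [hno, false_and, exists_false, ofPred_false, Submodule.span_empty] at hspan
  have := congrArg (fun S : Submodule ℝ (Euc d) => Module.finrank ℝ S) hspan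
  simp at this
  omega

namespace IsBipartiteWith

variable {d : ℕ} {P V₁ V₂ : Set (Euc d)} {r₁ r₂ l : ℝ}

lemma mem_right_of_isEdge (h : IsBipartiteWith P V₁ V₂ r₁ r₂ l) {v w : Euc d} (hv : v ∈ V₁)
    (hvw : IsEdge P v w) : w ∈ V₂ := by
  obtain ⟨-, -, -, hdisj, hmem, -⟩ := h
  rcases hmem v w hvw with h1 | h1
  · exact h1.2
  · exact (disjoint_left.1 hdisj hv h1.1).elim

lemma mem_left_of_isEdge (h : IsBipartiteWith P V₁ V₂ r₁ r₂ l) {v w : Euc d} (hv : v ∈ V₂)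
    (hvw : IsEdge P v w) : w ∈ V₁ := by
  obtain ⟨-, -, -, hdisj, hmem, -⟩ := h
  rcases hmem v w hvw with h1 | h1
  · exact (disjoint_left.1 hdisj h1.1 hv).elim
  · exact h1.2

lemma inner_eq_of_isEdge (h : IsBipartiteWith P V₁ V₂ r₁ r₂ l) {v w : Euc d}
    (hvw : IsEdge P v w) : inner ℝ v w = (r₁ ^ 2 + r₂ ^ 2 - l ^ 2) / 2 := by
  obtain ⟨-, hlen, -, -, hmem, -, -, hV₁, hV₂⟩ := h
  have h1 := norm_sub_sq_real v w
  rw [hlen v w hvw] at h1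
  rcases hmem v w hvw with ⟨hv, hw⟩ | ⟨hv, hw⟩
  · rw [hV₁ v hv, hV₂ w hw] at h1
    linarith
  · rw [hV₂ v hv, hV₁ w hw] at h1
    linarith

lemma const_lt_sq (h : IsBipartiteWith P V₁ V₂ r₁ r₂ l) (hP : IsPolytope P)
    (hfull : FullDim P) (hd : 1 < d) : (r₁ ^ 2 + r₂ ^ 2 - l ^ 2) / 2 < r₁ ^ 2 := by
  by_contra! hκ
  have hall := h
  obtain ⟨-, -, hX, -, hmem, hr₁, -, hV₁, hV₂⟩ := hall
  obtain ⟨x, hx⟩ := hP.extremePoints_nonempty hfull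
  obtain ⟨y, hxy⟩ := hP.exists_isEdge hfull (by omega) hx
  obtain ⟨v, hv, w, hw⟩ : ∃ v, v ∈ V₁ ∧ ∃ w, w ∈ V₂ := by
    rcases hmem x y hxy with hh | hh
    · exact ⟨x, hh.1, y, hh.2⟩
    · exact ⟨y, hh.2, x, hh.1⟩
  have hvX : v ∈ P.extremePoints ℝ := hX ▸ Or.inl hv
  have hwX : w ∈ P.extremePoints ℝ := hX ▸ Or.inr hw
  have huniq : ∀ z ∈ V₁, z = v := by
    intro z hz
    have hzX : z ∈ P.extremePoints ℝ := hX ▸ Or.inl hz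
    have := hP.apply_nonneg_of_edges hvX hzX.1 (innerSL ℝ v) fun y hy => by
      rw [innerSL_apply_apply, inner_sub_right, h.inner_eq_of_isEdge hy,
        real_inner_self_eq_norm_sq, hV₁ v hv]
      linarith
    rw [innerSL_apply_apply, inner_sub_right, real_inner_self_eq_norm_sq, hV₁ v hv] at this
    rw [← sub_eq_zero, ← norm_eq_zero, ← sq_eq_zero_iff, norm_sub_sq_real, hV₁ z hz, hV₁ v hv,
      real_inner_comm]
    refine le_antisymm (by linarith) ?_
    have := real_inner_le_norm v z
    rw [hV₁ z hz, hV₁ v hv] at this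
    linarith
  have hsub : {u | ∃ z, IsEdge P w z ∧ u = z - w} ⊆ {v - w} := by
    rintro _ ⟨z, hz, rfl⟩
    rw [huniq z (h.mem_left_of_isEdge hw hz), mem_singleton_iff]
  have htop := hP.span_edges_eq_top hfull hwX
  have hle := Submodule.span_mono (R := ℝ) hsub
  rw [htop, top_le_iff] at hle
  have := finrank_span_le_card (R := ℝ) ({v - w} : Set (Euc d))
  rw [hle, finrank_top, finrank_euclideanSpace_fin, toFinset_singleton,
    Finset.card_singleton] at this
  omega

lemma inner_lt_norm_sq (h : IsBipartiteWith P V₁ V₂ r₁ r₂ l) (hr : r₁ < r₂) (hP : IsPolytope P)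
    (hfull : FullDim P) (hd : 1 < d) {x y : Euc d} (hx : x ∈ P.extremePoints ℝ)
    (hy : y ∈ P) (hxy : x ≠ y) : inner ℝ x y < inner ℝ x x := by
  have hκ := h.const_lt_sq hP hfull hd
  have hall := h
  obtain ⟨-, -, hX, -, -, hr₁, -, hV₁, hV₂⟩ := hall
  have hle : r₁ ^ 2 ≤ inner ℝ x x := by
    rw [real_inner_self_eq_norm_sq]
    rw [← hX] at hx
    rcases hx with hx | hx
    · rw [hV₁ x hx]
    · rw [hV₂ x hx]
      nlinarith
  have := hP.apply_pos_of_edges hx hy hxy.symm (-innerSL ℝ x) fun z hz => by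
    rw [neg_apply, innerSL_apply_apply, inner_sub_right,
      h.inner_eq_of_isEdge hz]
    linarith
  rw [neg_apply, innerSL_apply_apply, inner_sub_right] at this
  linarith

/-- Among pairs of distinct vertices, the edges are those with the largest inner product. -/
lemma inner_le_of_ne (h : IsBipartiteWith P V₁ V₂ r₁ r₂ l) (hr : r₁ < r₂) (hP : IsPolytope P)
    (hfull : FullDim P) (hd : 1 < d) {x y : Euc d} (hx : x ∈ P.extremePoints ℝ)
    (hy : y ∈ P.extremePoints ℝ) (hxy : x ≠ y) :
    inner ℝ x y ≤ (r₁ ^ 2 + r₂ ^ 2 - l ^ 2) / 2 := by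
  classical
  obtain ⟨⟨a, b⟩, hab, hmax⟩ := hP.finite_extremePoints.toFinset.offDiag.exists_max_image
    (fun p => inner ℝ p.1 p.2) ⟨(x, y), by simp [hx, hy, hxy]⟩
  simp only [Finset.mem_offDiag, Finite.mem_toFinset, Prod.forall] at hab hmax
  obtain ⟨ha, hb, hne⟩ := hab
  have ha' := h.inner_lt_norm_sq hr hP hfull hd ha hb.1 hne
  have hb' := h.inner_lt_norm_sq hr hP hfull hd hb ha.1 hne.symm
  have hcomm := real_inner_comm a b
  have hedge : IsEdge P a b := by
    refine ⟨hne, ?_⟩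
    rw [← hP.convexHull_extremePoints]
    refine isExposed_segment_of_forall_lt ha hb (innerSL ℝ
      ((inner ℝ b b - inner ℝ a b) • a + (inner ℝ a a - inner ℝ a b) • b)) ?_ ?_
    · simp only [innerSL_apply_apply, inner_add_left, real_inner_smul_left, hcomm]
      ring
    · intro z hz hza hzb
      simp only [innerSL_apply_apply, inner_add_left, real_inner_smul_left, hcomm]
      have h1 := hmax a z ⟨ha, hz, hza.symm⟩
      have h2 := hmax b z ⟨hb, hz, hzb.symm⟩
      rw [hcomm] at hb'
      nlinarith [mul_nonneg (sub_pos.2 hb').le (sub_nonneg.2 h1),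
        mul_nonneg (sub_pos.2 ha').le (sub_nonneg.2 h2), mul_pos (sub_pos.2 hb') (sub_pos.2 ha')]
  rw [← h.inner_eq_of_isEdge hedge]
  exact hmax x y ⟨hx, hy, hxy⟩

/-- Two neighbours of an inner vertex form an obtuse angle as seen from its axis. -/
lemma inner_lt_of_isEdge (h : IsBipartiteWith P V₁ V₂ r₁ r₂ l) (hr : r₁ < r₂)
    (hP : IsPolytope P) (hfull : FullDim P) (hd : 1 < d) {v w w' : Euc d} (hv : v ∈ V₁)
    (hw : IsEdge P v w) (hw' : IsEdge P v w') (hne : w ≠ w') :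
    inner ℝ w w' < ((r₁ ^ 2 + r₂ ^ 2 - l ^ 2) / 2) ^ 2 / r₁ ^ 2 := by
  by_contra! hge
  have hwV := h.mem_right_of_isEdge hv hw
  have hwV' := h.mem_right_of_isEdge hv hw'
  have hκ := h.const_lt_sq hP hfull hd
  have hbd := fun x y => h.inner_le_of_ne (x := x) (y := y) hr hP hfull hd
  have hall := h
  obtain ⟨-, -, hX, hdisj, hmem, hr₁, -, -, hV₂⟩ := hall
  set κ := (r₁ ^ 2 + r₂ ^ 2 - l ^ 2) / 2
  have hwX : w ∈ P.extremePoints ℝ := hX ▸ Or.inr hwV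
  have hwX' : w' ∈ P.extremePoints ℝ := hX ▸ Or.inr hwV'
  have hsq : r₁ ^ 2 < r₂ ^ 2 := by nlinarith
  have hlarge : 2 * κ < r₂ ^ 2 + inner ℝ w w' := by
    have h1 : 2 * κ ≤ r₁ ^ 2 + κ ^ 2 / r₁ ^ 2 := by
      have : r₁ ^ 2 + κ ^ 2 / r₁ ^ 2 - 2 * κ = (r₁ - κ / r₁) ^ 2 := by
        field_simp
        ring
      nlinarith [sq_nonneg (r₁ - κ / r₁)]
    linarith
  have hedge : IsEdge P w w' := by
    refine ⟨hne, ?_⟩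
    rw [← hP.convexHull_extremePoints]
    refine isExposed_segment_of_forall_lt hwX hwX' (innerSL ℝ (w + w')) ?_ ?_
    · simp only [innerSL_apply_apply, inner_add_left, real_inner_self_eq_norm_sq, hV₂ w hwV,
        hV₂ w' hwV', real_inner_comm w w']
      ring
    · intro z hz hzw hzw'
      simp only [innerSL_apply_apply, inner_add_left, real_inner_self_eq_norm_sq, hV₂ w hwV,
        real_inner_comm w w']
      linarith [hbd w z hwX hz hzw.symm, hbd w' z hwX' hz hzw'.symm]
  exact disjoint_left.1 hdisj (h.mem_left_of_isEdge hwV hedge) hwV'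

/-- If a closed half-space through the origin contains `P`, then some half-space not containing
the origin in its interior supports `P` at an inner vertex. -/
lemma exists_support (h : IsBipartiteWith P V₁ V₂ r₁ r₂ l) (hr : r₁ < r₂) (hP : IsPolytope P)
    (hfull : FullDim P) (hd : 1 < d) {n : Euc d} (hn : n ≠ 0)
    (hnP : ∀ x ∈ P, 0 ≤ inner ℝ n x) :
    ∃ m : Euc d, m ≠ 0 ∧ ∃ v ∈ V₁, 0 ≤ inner ℝ m v ∧ ∀ x ∈ P, inner ℝ m v ≤ inner ℝ m x := by
  have hκ := h.const_lt_sq hP hfull hd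
  have hall := h
  obtain ⟨-, -, hX, -, -, hr₁, -, hV₁, hV₂⟩ := hall
  obtain ⟨w, hw, hmin⟩ := hP.finite_extremePoints.toFinset.exists_min_image
    (fun x => inner ℝ n x) (by simpa using hP.extremePoints_nonempty hfull)
  simp only [Finite.mem_toFinset] at hw hmin
  have hminP : ∀ x ∈ P, inner ℝ n w ≤ inner ℝ n x := by
    intro x hx
    rw [← hP.convexHull_extremePoints] at hx
    exact convexHull_min (fun z hz => hmin z hz)
      (convex_halfSpace_ge (innerSL ℝ n).isLinear (inner ℝ n w)) hx
  have hwn := hnP w hw.1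
  have hw' := hw
  rw [← hX] at hw
  rcases hw with hw | hw
  · exact ⟨n, hn, w, hw, hwn, hminP⟩
  have hfin : {z | IsEdge P w z}.Finite := hP.finite_extremePoints.subset fun z hz =>
    hX ▸ Or.inl (h.mem_left_of_isEdge hw hz)
  obtain ⟨v, hv, hvmin⟩ := hfin.toFinset.exists_min_image (fun x => inner ℝ n x)
    (hfin.toFinset_nonempty.2 (hP.exists_isEdge hfull (by omega) hw'))
  simp only [Finite.mem_toFinset] at hv hvmin
  have hv : IsEdge P w v := hv
  have hvV := h.mem_left_of_isEdge hw hv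
  have hvX : v ∈ P.extremePoints ℝ := hX ▸ Or.inl hvV
  have hsq : r₁ ^ 2 < r₂ ^ 2 := by nlinarith
  have hinner := fun z (hz : IsEdge P w z) => h.inner_eq_of_isEdge hz
  set κ := (r₁ ^ 2 + r₂ ^ 2 - l ^ 2) / 2
  have hpos : 0 < r₂ ^ 2 - κ := by linarith
  set t := (inner ℝ n v - inner ℝ n w) / (r₂ ^ 2 - κ) with ht
  have ht0 : 0 ≤ t := div_nonneg (by linarith [hminP v hvX.1]) hpos.le
  have htmul : t * (r₂ ^ 2 - κ) = inner ℝ n v - inner ℝ n w := div_mul_cancel₀ _ hpos.ne'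
  have hww : inner ℝ w w = r₂ ^ 2 := by rw [real_inner_self_eq_norm_sq, hV₂ w hw]
  have hmw : inner ℝ (n + t • w) w = inner ℝ n w + t * r₂ ^ 2 := by
    rw [inner_add_left, real_inner_smul_left, hww]
  have hmv : inner ℝ (n + t • w) v = inner ℝ (n + t • w) w := by
    rw [hmw, inner_add_left, real_inner_smul_left, hinner v hv]
    linarith
  have htr : 0 ≤ t * r₂ ^ 2 := by positivity
  refine ⟨n + t • w, fun h0 => ?_, v, hvV, by linarith, fun x hx => ?_⟩
  · rw [h0, inner_zero_left] at hmw
    have : t * r₂ ^ 2 = 0 := by linarith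
    have ht : t = 0 := (mul_eq_zero.1 this).resolve_right (by nlinarith)
    rw [ht, zero_smul, add_zero] at h0
    exact hn h0
  · have := hP.apply_nonneg_of_edges hw' hx (innerSL ℝ (n + t • w)) fun z hz => by
      rw [innerSL_apply_apply, inner_sub_right, hmw, inner_add_left, real_inner_smul_left,
        hinner z hz]
      linarith [hvmin z hz]
    rw [innerSL_apply_apply, inner_sub_right] at this
    linarith

end IsBipartiteWith

lemma IsPolytope.exists_halfSpace {d : ℕ} {P : Set (Euc d)} (hP : IsPolytope P)
    (hfull : FullDim P) (h0 : (0 : Euc d) ∉ interior P) :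
    ∃ n : Euc d, n ≠ 0 ∧ ∀ x ∈ P, 0 ≤ inner ℝ n x := by
  obtain ⟨f, hf⟩ := geometric_hahn_banach_open_point hP.convex.interior isOpen_interior h0
  have hne : (interior P).Nonempty := hP.convex.interior_nonempty_iff_affineSpan_eq_top.2 hfull
  simp only [map_zero] at hf
  have hle : ∀ x ∈ P, f x ≤ 0 := by
    have hcl : closure (interior P) ⊆ {x | f x ≤ 0} :=
      closure_minimal (fun x hx => (hf x hx).le) (isClosed_le f.continuous continuous_const)
    rw [hP.convex.closure_interior_eq_closure_of_nonempty_interior hne] at hcl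
    exact fun x hx => hcl (subset_closure hx)
  have hrep : ∀ x, inner ℝ ((InnerProductSpace.toDual ℝ (Euc d)).symm f) x = f x := fun x =>
    InnerProductSpace.toDual_symm_apply
  refine ⟨-(InnerProductSpace.toDual ℝ (Euc d)).symm f, fun h => ?_, fun x hx => ?_⟩
  · obtain ⟨x, hx⟩ := hne
    have := hrep x
    rw [neg_eq_zero.1 h, inner_zero_left] at this
    exact (hf x hx).ne this.symm
  · rw [inner_neg_left, hrep]
    linarith [hle x hx]

lemma IsPolytope.exists_three_isEdge {P : Set (Euc 3)} (hP : IsPolytope P) (hfull : FullDim P)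
    {v : Euc 3} (hv : v ∈ P.extremePoints ℝ) (hfin : {w | IsEdge P v w}.Finite) :
    ∃ a b c, IsEdge P v a ∧ IsEdge P v b ∧ IsEdge P v c ∧ a ≠ b ∧ a ≠ c ∧ b ≠ c := by
  have htop := hP.span_edges_eq_top hfull hv
  have himg : {u | ∃ w, IsEdge P v w ∧ u = w - v} = (fun w => w - v) '' {w | IsEdge P v w} := by
    ext u
    simp [eq_comm]
  have hcard : 2 < {w | IsEdge P v w}.ncard := by
    have h1 := (hfin.image fun w => w - v)
    rw [himg] at htop
    have := h1.fintype
    have h2 := finrank_span_le_card (R := ℝ) ((fun w => w - v) '' {w | IsEdge P v w})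
    rw [htop, finrank_top, finrank_euclideanSpace_fin, ← ncard_eq_toFinset_card'] at h2
    exact h2.trans (ncard_image_le hfin)
  obtain ⟨a, b, c, ha, hb, hc, hh⟩ := (two_lt_ncard_iff hfin).1 hcard
  exact ⟨a, b, c, ha, hb, hc, hh⟩

/-- A full-dimensional strictly bipartite polyhedron in `ℝ³` contains the
origin in its interior. -/
theorem origin_mem_interior_of_strictlyBipartite
    (P : Set (Euc 3)) (hP : IsPolytope P) (hfull : FullDim P)
    (hbip : IsStrictlyBipartite P) :
    (0 : Euc 3) ∈ interior P := by
  obtain ⟨V₁, V₂, r₁, r₂, l, h, hr⟩ := hbip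
  by_contra h0
  obtain ⟨n, hn, hnP⟩ := hP.exists_halfSpace hfull h0
  obtain ⟨m, hm, v, hv, hmv, hmP⟩ := h.exists_support hr hP hfull (by norm_num) hn hnP
  have hκ := h.const_lt_sq hP hfull (by norm_num)
  have hobt := fun w w' => h.inner_lt_of_isEdge (w := w) (w' := w') hr hP hfull (by norm_num) hv
  have hinner := fun w (hw : IsEdge P v w) => h.inner_eq_of_isEdge hw
  have hnbr := fun w (hw : IsEdge P v w) => h.mem_right_of_isEdge hv hw
  obtain ⟨-, -, hX, -, -, hr₁, -, hV₁, -⟩ := h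
  have hvX : v ∈ P.extremePoints ℝ := hX ▸ Or.inl hv
  have hnX : ∀ w, IsEdge P v w → w ∈ P.extremePoints ℝ := fun w hw => hX ▸ Or.inr (hnbr w hw)
  have hvv : inner ℝ v v = r₁ ^ 2 := by rw [real_inner_self_eq_norm_sq, hV₁ v hv]
  have hr₁' : 0 < r₁ ^ 2 := by positivity
  have hv0 : v ≠ 0 := by
    rintro rfl
    rw [inner_zero_left] at hvv
    linarith
  set κ := (r₁ ^ 2 + r₂ ^ 2 - l ^ 2) / 2
  obtain ⟨a, b, c, ha, hb, hc, hab, hac, hbc⟩ := hP.exists_three_isEdge hfull hvX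
    (hP.finite_extremePoints.subset hnX)
  -- `w - (κ / r₁ ^ 2) • v` is the component of a neighbour `w` of `v` orthogonal to `v`
  have horth : ∀ w, IsEdge P v w → inner ℝ v (w - (κ / r₁ ^ 2) • v) = 0 := by
    intro w hw
    rw [inner_sub_right, real_inner_smul_right, hinner w hw, hvv]
    field_simp
    ring
  have hneg : ∀ w w', IsEdge P v w → IsEdge P v w' → w ≠ w' →
      inner ℝ (w - (κ / r₁ ^ 2) • v) (w' - (κ / r₁ ^ 2) • v) < 0 := by
    intro w w' hw hw' hne
    have h1 := hobt w w' hw hw' hne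
    rw [inner_sub_left, real_inner_smul_left, horth w' hw', inner_sub_right,
      real_inner_smul_right, real_inner_comm v w, hinner w hw]
    have : κ / r₁ ^ 2 * κ = κ ^ 2 / r₁ ^ 2 := by ring
    linarith
  have hp : ∀ w, IsEdge P v w →
      inner ℝ ((inner ℝ m v / r₁ ^ 2) • v - m) (w - (κ / r₁ ^ 2) • v) ≤ 0 := by
    intro w hw
    rw [inner_sub_left, real_inner_smul_left, horth w hw, inner_sub_right,
      real_inner_smul_right]
    have h1 := hmP w (hnX w hw).1
    have h2 : κ / r₁ ^ 2 ≤ 1 := by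
      rw [div_le_one hr₁']
      exact hκ.le
    nlinarith
  have hpv : inner ℝ v ((inner ℝ m v / r₁ ^ 2) • v - m) = 0 := by
    rw [inner_sub_right, real_inner_smul_right, hvv, real_inner_comm m v]
    field_simp
    ring
  have hzero := eq_zero_of_pairwise_obtuse hv0 (horth a ha) (horth b hb) (horth c hc) hpv
    (hneg a b ha hb hab) (hneg a c ha hc hac) (hneg b c hb hc hbc) (hp a ha) (hp b hb) (hp c hc)
  have hmeq : m = (inner ℝ m v / r₁ ^ 2) • v := (sub_eq_zero.1 hzero).symm
  have hpos : 0 < inner ℝ m v / r₁ ^ 2 := by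
    refine lt_of_le_of_ne (by positivity) fun hz => hm ?_
    rw [hmeq, ← hz, zero_smul]
  have hle := hmP a (hnX a ha).1
  set s := inner ℝ m v / r₁ ^ 2
  rw [hmeq, real_inner_smul_left, real_inner_smul_left, hvv, hinner a ha] at hle
  nlinarith
end
end

section
/- Let P ⊆ ℝ³ be a full-dimensional strictly bipartite convex polytope, and let F1, F2 be exposed faces of P whose affine spans have dimension 2. If F1 and F2 have the same (finite) number of vertices (extreme points), then F1 and F2 are congruent: there is an isometry of ℝ³ mapping F1 onto F2; moreover the affine spans of F1 and F2 have the same distance from the origin. -/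
open Set Pointwise

noncomputable section

/-- The planar cross product (determinant) of two complex numbers. -/
def cross (x y : ℂ) : ℝ := x.re * y.im - x.im * y.re

/-- `y` follows `x` in the counterclockwise order of the points of `X`: all other points of `X`
lie strictly to the left of the line from `x` to `y`. -/
def IsPolygonEdge (X : Set ℂ) (x y : ℂ) : Prop :=
  x ∈ X ∧ y ∈ X ∧ x ≠ y ∧ ∀ p ∈ X, p ≠ x → p ≠ y → 0 < cross (y - x) (p - x)

/-- The polygon vertices at angles `j * α`, `j < N`, with radii alternating between `ρ₂`, `ρ₁`. -/
def alternatingVertices (N : ℕ) (ρ₁ ρ₂ : ℝ) : Set ℂ :=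
  (fun j : ℕ => (((if Even j then ρ₂ else ρ₁ : ℝ) : ℂ) *
    Complex.exp ((j * (2 * Real.pi / N) : ℝ) * Complex.I))) '' Set.Iio N

lemma isExposed_convexHull_trans {E : Type*} [NormedAddCommGroup E] [NormedSpace ℝ E]
    (S : Finset E) {F G : Set E} (hF : IsExposed ℝ (convexHull ℝ (S : Set E)) F)
    (hG : IsExposed ℝ F G) : IsExposed ℝ (convexHull ℝ (S : Set E)) G := by
  rintro ⟨x₀, hx₀⟩
  have hx₀F : x₀ ∈ F := hG.subset hx₀
  obtain ⟨f, hf⟩ := hF ⟨x₀, hx₀F⟩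
  obtain ⟨g, hg⟩ := hG ⟨x₀, hx₀⟩
  have hx₀P := hF.subset hx₀F
  have hfmax : ∀ y ∈ convexHull ℝ (S : Set E), f y ≤ f x₀ := by
    rw [hf] at hx₀F; exact hx₀F.2
  have hgmax : ∀ y ∈ F, g y ≤ g x₀ := by
    rw [hg] at hx₀; exact hx₀.2
  have hmemF : ∀ y ∈ convexHull ℝ (S : Set E), f y = f x₀ → y ∈ F := by
    intro y hy h
    rw [hf]
    exact ⟨hy, fun z hz => h ▸ hfmax z hz⟩
  obtain ⟨K, hK⟩ : ∃ K : ℝ, ∀ s ∈ S,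
      f x₀ - f s ≤ K * (f x₀ - f s) + (g x₀ - g s) := by
    refine ⟨1 + ∑ s ∈ S, |g x₀ - g s| / |f x₀ - f s|, fun s hs => ?_⟩
    have hsP := subset_convexHull ℝ _ (Finset.mem_coe.2 hs)
    rcases (hfmax s hsP).eq_or_lt with h | h
    · have := hgmax s (hmemF s hsP h)
      rw [h]; linarith
    · have h1 : |g x₀ - g s| / |f x₀ - f s| ≤ ∑ s ∈ S, |g x₀ - g s| / |f x₀ - f s| :=
        Finset.single_le_sum (f := fun s => |g x₀ - g s| / |f x₀ - f s|)
          (fun _ _ => by positivity) hs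
      have hpos : 0 < f x₀ - f s := by linarith
      rw [abs_of_pos hpos, div_le_iff₀ hpos] at h1
      have := neg_abs_le (g x₀ - g s)
      linarith
  have hKP : ∀ y ∈ convexHull ℝ (S : Set E),
      f x₀ - f y ≤ K * (f x₀ - f y) + (g x₀ - g y) := by
    have hconv : Convex ℝ {y : E | ((K - 1) • f + g) y ≤ ((K - 1) • f + g) x₀} :=
      convex_halfSpace_le ((K - 1) • f + g).toLinearMap.isLinear _
    have hsub := convexHull_min (s := (S : Set E)) (fun s hs => ?_) hconv
    · intro y hy
      have := hsub hy
      simp only [Set.mem_ofPred_eq, add_apply, smul_apply,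
        smul_eq_mul] at this
      linarith
    · have := hK s hs
      simp only [Set.mem_ofPred_eq, add_apply, smul_apply,
        smul_eq_mul]
      linarith
  refine ⟨K • f + g, Set.ext fun y => ⟨fun hy => ⟨hF.subset (hG.subset hy), fun z hz => ?_⟩,
    fun hy => ?_⟩⟩
  · have hyF := hG.subset hy
    have h1 : f x₀ ≤ f y := by rw [hf] at hyF; exact hyF.2 _ hx₀P
    have h2 : g x₀ ≤ g y := by rw [hg] at hy; exact hy.2 _ (hG.subset hx₀)
    have h3 := hKP z hz
    have h4 := hfmax z hz
    have h5 := hfmax y (hF.subset hyF)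
    have h6 : f y = f x₀ := le_antisymm h5 h1
    simp only [add_apply, smul_apply, smul_eq_mul]
    rw [h6]
    linarith
  · obtain ⟨hyP, hy⟩ := hy
    have h1 := hy x₀ hx₀P
    simp only [add_apply, smul_apply, smul_eq_mul] at h1
    have h2 := hKP y hyP
    have h3 : f y = f x₀ := le_antisymm (hfmax y hyP) (by linarith)
    rw [h3] at h1
    rw [hg]
    exact ⟨hmemF y hyP h3, fun z hz => (hgmax z hz).trans (by linarith)⟩

lemma exists_cross_pos_of_convexPosition {X : Set ℂ} (hX : X.Finite)
    (hconv : ∀ x ∈ X, x ∉ convexHull ℝ (X \ {x})) {x x' : ℂ} (hx : x ∈ X) (hx' : x' ∈ X)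
    (hne : x' ≠ x) {ε : ℝ} (hε : ε ≠ 0) :
    ∃ y ∈ X, y ≠ x ∧ ∀ p ∈ X, p ≠ x → p ≠ y → 0 < ε * cross (y - x) (p - x) := by
  have hfin : (X \ {x}).Finite := hX.subset Set.sdiff_subset
  obtain ⟨f, u, hfx, hfu⟩ := geometric_hahn_banach_point_closed (convex_convexHull ℝ (X \ {x}))
    (hfin.isCompact_convexHull ℝ).isClosed (hconv x hx)
  have hf : ∀ z : ℂ, f z = z.re * f 1 + z.im * f Complex.I := by
    intro z
    conv_lhs => rw [← Complex.re_add_im z]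
    have h1 : (z.re : ℂ) = z.re • (1 : ℂ) := by simp
    have h2 : (z.im : ℂ) * Complex.I = z.im • Complex.I := by simp
    rw [h1, h2, map_add, map_smul, map_smul, smul_eq_mul, smul_eq_mul]
  set a := f 1
  set b := f Complex.I
  have hpos : ∀ p ∈ X, p ≠ x → 0 < f (p - x) := by
    intro p hp hpx
    have := hfu p (subset_convexHull ℝ _ ⟨hp, hpx⟩)
    rw [map_sub]; linarith
  obtain ⟨y, ⟨hyX, hyx⟩, hmin⟩ := Set.exists_min_image (X \ {x})
    (fun p => ε * (a * (p - x).im - b * (p - x).re) / f (p - x)) hfin ⟨x', hx', hne⟩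
  have hyx : y ≠ x := hyx
  refine ⟨y, hyX, hyx, fun p hp hpx hpy => ?_⟩
  have hfy := hpos y hyX hyx
  have hfp := hpos p hp hpx
  have hab : 0 < a ^ 2 + b ^ 2 := by
    rw [hf] at hfy
    by_contra h
    have ha : a = 0 := by nlinarith [sq_nonneg a, sq_nonneg b]
    have hb : b = 0 := by nlinarith [sq_nonneg a, sq_nonneg b]
    rw [ha, hb] at hfy
    simp at hfy
  have h1 := hmin p ⟨hp, hpx⟩
  rw [div_le_div_iff₀ hfy hfp] at h1
  have hkey : 0 ≤ ε * cross (y - x) (p - x) := by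
    refine nonneg_of_mul_nonneg_right (a := a ^ 2 + b ^ 2) ?_ hab
    rw [hf, hf] at h1
    unfold cross
    nlinarith
  refine lt_of_le_of_ne hkey fun h0 => ?_
  have hc : cross (y - x) (p - x) = 0 := by
    rcases mul_eq_zero.1 h0.symm with h | h
    · exact absurd h hε
    · exact h
  have hpar : f (y - x) • (p - x) = f (p - x) • (y - x) := by
    rw [hf, hf]
    unfold cross at hc
    apply Complex.ext
    · simp only [Complex.smul_re, smul_eq_mul]
      linear_combination (- b) * hc
    · simp only [Complex.smul_im, smul_eq_mul]
      linear_combination a * hc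
  have between : ∀ p q : ℂ, p ∈ X → q ∈ X → p ≠ x → q ≠ x → f (p - x) < f (q - x) →
      f (q - x) • (p - x) = f (p - x) • (q - x) → False := by
    intro p q hp hq hpx hqx hlt heq
    have h0p := hpos p hp hpx
    have h0q := hpos q hq hqx
    refine hconv p hp ?_
    have hxm : x ∈ X \ {p} := ⟨hx, fun h => hpx h.symm⟩
    have hqm : q ∈ X \ {p} := ⟨hq, fun h => by
      rw [Set.mem_singleton_iff] at h; subst h; exact lt_irrefl _ hlt⟩
    refine (convex_convexHull ℝ (X \ {p})).segment_subset (subset_convexHull ℝ _ hxm)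
      (subset_convexHull ℝ _ hqm) ?_
    rw [segment_eq_image']
    refine ⟨f (p - x) / f (q - x), ⟨by positivity, (div_le_one h0q).2 hlt.le⟩, ?_⟩
    have : (f (p - x) / f (q - x)) • (q - x) = p - x := by
      rw [div_eq_inv_mul, mul_smul, ← heq, smul_smul, inv_mul_cancel₀ h0q.ne', one_smul]
    simp only [this]
    ring
  rcases lt_trichotomy (f (p - x)) (f (y - x)) with h | h | h
  · exact between p y hp hyX hpx hyx h hpar
  · rw [h] at hpar
    exact hpy (sub_left_injective (smul_right_injective ℂ hfy.ne' hpar))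
  · exact between y p hyX hp hyx hpx h hpar.symm

lemma exists_next_of_convexPosition {X : Set ℂ} (hX : X.Finite)
    (hconv : ∀ x ∈ X, x ∉ convexHull ℝ (X \ {x})) {x x' : ℂ} (hx : x ∈ X) (hx' : x' ∈ X)
    (hne : x' ≠ x) : ∃ y, IsPolygonEdge X x y := by
  obtain ⟨y, hy, hyx, h⟩ := exists_cross_pos_of_convexPosition hX hconv hx hx' hne one_ne_zero
  exact ⟨y, hx, hy, hyx.symm, fun p hp hpx hpy => by simpa using h p hp hpx hpy⟩

lemma exists_prev_of_convexPosition {X : Set ℂ} (hX : X.Finite)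
    (hconv : ∀ x ∈ X, x ∉ convexHull ℝ (X \ {x})) {x x' : ℂ} (hx : x ∈ X) (hx' : x' ∈ X)
    (hne : x' ≠ x) : ∃ z, IsPolygonEdge X z x := by
  obtain ⟨y, hy, hyx, h⟩ := exists_cross_pos_of_convexPosition hX hconv hx hx' hne
    (neg_ne_zero.2 one_ne_zero)
  refine ⟨y, hy, hx, hyx, fun p hp hpy hpx => ?_⟩
  have := h p hp hpx hpy
  simp only [cross, Complex.sub_re, Complex.sub_im] at this ⊢
  linarith

/-- Two points `y`, `z` at equal distances from `0` and from `x ≠ 0` are mirror images in the line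
through `0` and `x`. -/
lemma cross_eq_neg_of_reflection {x y z : ℂ} (hx : x ≠ 0) (hn : ‖y‖ = ‖z‖)
    (hd : ‖x - y‖ = ‖x - z‖) (hc : 0 < cross (y - x) (z - x)) :
    cross x z = - cross x y ∧
      0 < (‖x‖ ^ 2 - (‖x‖ ^ 2 + ‖y‖ ^ 2 - ‖x - y‖ ^ 2) / 2) * cross x y := by
  have hx' : 0 < ‖x‖ ^ 2 := by positivity
  have hn' : ‖y‖ ^ 2 = ‖z‖ ^ 2 := by rw [hn]
  have hd' : ‖x - y‖ ^ 2 = ‖x - z‖ ^ 2 := by rw [hd]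
  simp only [Complex.sq_norm, Complex.normSq_apply, Complex.sub_re, Complex.sub_im] at hx' hn' hd' ⊢
  unfold cross at *
  simp only [Complex.sub_re, Complex.sub_im] at hc
  have hI : x.re * y.re + x.im * y.im = x.re * z.re + x.im * z.im := by linarith
  have hsq : (x.re * z.im - x.im * z.re - (x.re * y.im - x.im * y.re)) *
      (x.re * z.im - x.im * z.re + (x.re * y.im - x.im * y.re)) = 0 := by
    linear_combination (x.re * x.re + x.im * x.im) * (-hn') +
      (x.re * y.re + x.im * y.im + (x.re * z.re + x.im * z.im)) * hI
  have hprod : 0 < ((x.re * y.re + x.im * y.im) - (x.re * x.re + x.im * x.im)) *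
      (x.re * z.im - x.im * z.re - (x.re * y.im - x.im * y.re)) := by
    have := mul_pos hx' hc
    have e : (x.re * x.re + x.im * x.im) *
        ((y.re - x.re) * (z.im - x.im) - (y.im - x.im) * (z.re - x.re)) =
      ((x.re * y.re + x.im * y.im) - (x.re * x.re + x.im * x.im)) *
        (x.re * z.im - x.im * z.re - (x.re * y.im - x.im * y.re)) := by
      linear_combination (x.re * y.im - x.im * y.re) * hI
    rwa [e] at this
  rcases mul_eq_zero.1 hsq with h | h
  · rw [h, mul_zero] at hprod
    exact absurd hprod (lt_irrefl _)
  · refine ⟨by linarith, ?_⟩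
    have h' : x.re * z.im - x.im * z.re = -(x.re * y.im - x.im * y.re) := by linarith
    rw [h'] at hprod
    nlinarith

lemma IsPolygonEdge.cross_prev_pos {X : Set ℂ} {x y z : ℂ} (hy : IsPolygonEdge X x y)
    (hz : IsPolygonEdge X z x) (h3 : 3 ≤ X.ncard) : 0 < cross (y - x) (z - x) := by
  refine hy.2.2.2 z hz.1 hz.2.2.1 ?_
  rintro rfl
  obtain ⟨p, hp, hpx⟩ : ∃ p ∈ X, p ∉ ({x, z} : Set ℂ) := by
    by_contra! h
    have h2 : X.ncard ≤ ({x, z} : Set ℂ).ncard := Set.ncard_le_ncard h (Set.toFinite _)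
    rw [Set.ncard_pair hz.2.2.1.symm] at h2
    omega
  simp only [Set.mem_insert_iff, Set.mem_singleton_iff, not_or] at hpx
  have h1 := hy.2.2.2 p hp hpx.1 hpx.2
  have h2 := hz.2.2.2 p hp hpx.2 hpx.1
  simp only [cross, Complex.sub_re, Complex.sub_im] at h1 h2
  linarith

/-- In a polygon with edge length `ℓ` whose edges join points of norms `ρ₁ < ρ₂`, every edge turns
counterclockwise around `0`. -/
lemma edges_turn {X : Set ℂ} {ρ₁ ρ₂ ℓ : ℝ} (hρ₁ : 0 ≤ ρ₁) (hρ : ρ₁ < ρ₂) (h3 : 3 ≤ X.ncard)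
    (hnext : ∀ x ∈ X, ∃ y, IsPolygonEdge X x y) (hprev : ∀ x ∈ X, ∃ z, IsPolygonEdge X z x)
    (hedge : ∀ x y, IsPolygonEdge X x y →
      ‖x - y‖ = ℓ ∧ ((‖x‖ = ρ₁ ∧ ‖y‖ = ρ₂) ∨ (‖x‖ = ρ₂ ∧ ‖y‖ = ρ₁))) :
    (∀ x y, IsPolygonEdge X x y → 0 < cross x y) ∧ 0 < ρ₁ ∧
      (ρ₁ ^ 2 + ρ₂ ^ 2 - ℓ ^ 2) / 2 < ρ₁ ^ 2 := by
  have key : ∀ x y z, IsPolygonEdge X x y → IsPolygonEdge X z x → x ≠ 0 →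
      cross x z = - cross x y ∧ 0 < (‖x‖ ^ 2 - (ρ₁ ^ 2 + ρ₂ ^ 2 - ℓ ^ 2) / 2) * cross x y := by
    intro x y z hy hz hx
    obtain ⟨dy, ny⟩ := hedge x y hy
    obtain ⟨dz, nz⟩ := hedge z x hz
    have hyz : ‖y‖ = ‖z‖ := by
      rcases ny with ⟨h1, h2⟩ | ⟨h1, h2⟩ <;> rcases nz with ⟨h3, h4⟩ | ⟨h3, h4⟩ <;> linarith
    have := cross_eq_neg_of_reflection hx hyz (by rw [norm_sub_rev x z, dz, dy])
      (hy.cross_prev_pos hz h3)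
    refine ⟨this.1, ?_⟩
    convert this.2 using 4
    rw [dy]
    rcases ny with ⟨h1, h2⟩ | ⟨h1, h2⟩ <;> rw [h1, h2]
    ring
  have outer : ∀ x y z, IsPolygonEdge X x y → IsPolygonEdge X z x → ‖x‖ = ρ₂ →
      0 < cross x y ∧ 0 < cross z x := by
    intro x y z hy hz hx
    have hx0 : x ≠ 0 := by
      rintro rfl
      rw [norm_zero] at hx
      linarith
    obtain ⟨h1, h2⟩ := key x y z hy hz hx0
    rw [hx] at h2
    have h4 : 0 < cross x y := by
      refine (pos_iff_pos_of_mul_pos h2).1 ?_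
      nlinarith [sq_nonneg ℓ]
    refine ⟨h4, ?_⟩
    unfold cross at *
    linarith
  have hpos : ∀ x y, IsPolygonEdge X x y → 0 < cross x y := by
    intro x y hy
    rcases (hedge x y hy).2 with ⟨-, h⟩ | ⟨h, -⟩
    · obtain ⟨y', hy'⟩ := hnext y hy.2.1
      exact (outer y y' x hy' hy h).2
    · obtain ⟨z, hz⟩ := hprev x hy.1
      exact (outer x y z hy hz h).1
  refine ⟨hpos, ?_⟩
  obtain ⟨v, hv, hvn⟩ : ∃ v ∈ X, ‖v‖ = ρ₁ := by
    obtain ⟨x, hx⟩ := Set.nonempty_of_ncard_ne_zero (s := X) (by omega)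
    obtain ⟨y, hy⟩ := hnext x hx
    rcases (hedge x y hy).2 with ⟨h, -⟩ | ⟨-, h⟩
    · exact ⟨x, hx, h⟩
    · exact ⟨y, hy.2.1, h⟩
  obtain ⟨y, hy⟩ := hnext v hv
  obtain ⟨z, hz⟩ := hprev v hv
  have hc := hpos v y hy
  have hv0 : v ≠ 0 := by
    rintro rfl
    simp [cross] at hc
  refine ⟨hvn ▸ norm_pos_iff.2 hv0, ?_⟩
  have := (pos_iff_pos_of_mul_pos (key v y z hy hz hv0).2).2 hc
  rw [hvn] at this
  linarith

/-- No vertex lies in the angular sector between two consecutive vertices. -/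
lemma eq_of_mem_sector {X : Set ℂ} (hnext : ∀ x ∈ X, ∃ y, IsPolygonEdge X x y)
    (hturn : ∀ x y, IsPolygonEdge X x y → 0 < cross x y) {x y p : ℂ} (hxy : IsPolygonEdge X x y)
    (hp : p ∈ X) (h1 : 0 ≤ cross x p) (h2 : 0 < cross p y) : p = x := by
  by_contra hpx
  have hpy : p ≠ y := by
    rintro rfl
    simp [cross, mul_comm] at h2
  have hm := hturn x y hxy
  obtain ⟨q, hq⟩ := hnext p hp
  have hpq := hturn p q hq
  have hD : ∀ r ∈ X, 0 ≤ cross (q - p) (r - p) := by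
    intro r hr
    by_cases hrp : r = p
    · simp [hrp, cross]
    by_cases hrq : r = q
    · rw [hrq]
      unfold cross
      linarith
    · exact (hq.2.2.2 r hr hrp hrq).le
  have hDx := hD x hxy.1
  have hDy := hD y hxy.2.1
  have hE := hxy.2.2.2 p hp hpx hpy
  have e1 : cross p y * cross (q - p) (x - p) + cross x p * cross (q - p) (y - p) +
      cross (y - x) (p - x) * cross p q = 0 := by
    simp only [cross, Complex.sub_re, Complex.sub_im]
    ring
  have := mul_pos hE hpq
  have := mul_nonneg h2.le hDx
  have := mul_nonneg h1 hDy
  linarith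

lemma cross_polar (a b θ φ : ℝ) {u : ℂ} (hu : ‖u‖ = 1) :
    cross (a * (u * Complex.exp (θ * Complex.I))) (b * (u * Complex.exp (φ * Complex.I))) =
      a * b * Real.sin (φ - θ) := by
  have hu' : u.re * u.re + u.im * u.im = 1 := by
    rw [← Complex.normSq_apply, ← Complex.sq_norm, hu, one_pow]
  rw [Real.sin_sub]
  simp only [cross, Complex.mul_re, Complex.mul_im, Complex.ofReal_re, Complex.ofReal_im,
    Complex.exp_ofReal_mul_I_re, Complex.exp_ofReal_mul_I_im]
  linear_combination a * b * (Real.cos θ * Real.sin φ - Real.sin θ * Real.cos φ) * hu'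

/-- Two points spanning the angle `α` are related by a rotation by `α` and a rescaling. -/
lemma norm_mul_eq_of_cross {x y : ℂ} {α : ℝ} (hc : cross x y = ‖x‖ * ‖y‖ * Real.sin α)
    (hI : x.re * y.re + x.im * y.im = ‖x‖ * ‖y‖ * Real.cos α) (hx : x ≠ 0) :
    (‖x‖ : ℂ) * y = ‖y‖ * (x * Complex.exp (α * Complex.I)) := by
  have hx' : (‖x‖ : ℂ) ≠ 0 := by simpa using hx
  refine mul_left_cancel₀ hx' ?_
  have hn : ‖x‖ ^ 2 = x.re * x.re + x.im * x.im := by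
    rw [← Complex.normSq_apply, ← Complex.sq_norm]
  unfold cross at hc
  apply Complex.ext
  · simp only [Complex.mul_re, Complex.mul_im, Complex.ofReal_re, Complex.ofReal_im,
      Complex.exp_ofReal_mul_I_re, Complex.exp_ofReal_mul_I_im]
    linear_combination y.re * hn + x.re * hI - x.im * hc
  · simp only [Complex.mul_re, Complex.mul_im, Complex.ofReal_re, Complex.ofReal_im,
      Complex.exp_ofReal_mul_I_re, Complex.exp_ofReal_mul_I_im]
    linear_combination y.im * hn + x.im * hI + x.re * hc

/-- A polygon with edges of length `ℓ` joining points of norms `ρ₁ < ρ₂` is, up to rotation,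
the polygon with alternating radii and equal angles. -/
theorem eq_image_alternatingVertices {X : Set ℂ} {ρ₁ ρ₂ ℓ : ℝ} (hρ₁ : 0 ≤ ρ₁) (hρ : ρ₁ < ρ₂)
    (h3 : 3 ≤ X.ncard)
    (hnext : ∀ x ∈ X, ∃ y, IsPolygonEdge X x y) (hprev : ∀ x ∈ X, ∃ z, IsPolygonEdge X z x)
    (hedge : ∀ x y, IsPolygonEdge X x y →
      ‖x - y‖ = ℓ ∧ ((‖x‖ = ρ₁ ∧ ‖y‖ = ρ₂) ∨ (‖x‖ = ρ₂ ∧ ‖y‖ = ρ₁))) :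
    0 < ρ₁ ∧
    2 * ρ₁ * ρ₂ * Real.cos (2 * Real.pi / X.ncard) = ρ₁ ^ 2 + ρ₂ ^ 2 - ℓ ^ 2 ∧
    ρ₁ ^ 2 + ρ₂ ^ 2 - ℓ ^ 2 < 2 * ρ₁ ^ 2 ∧
    ∃ u : ℂ, ‖u‖ = 1 ∧ X = (fun z => u * z) '' alternatingVertices X.ncard ρ₁ ρ₂ := by
  obtain ⟨hturn, hρ₁pos, hk⟩ := edges_turn hρ₁ hρ h3 hnext hprev hedge
  set k : ℝ := (ρ₁ ^ 2 + ρ₂ ^ 2 - ℓ ^ 2) / 2 with hkdef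
  have hρ₂pos : 0 < ρ₂ := hρ₁pos.trans hρ
  have hρρ : 0 < ρ₁ * ρ₂ := mul_pos hρ₁pos hρ₂pos
  have hmul : ∀ x y, IsPolygonEdge X x y → ‖x‖ * ‖y‖ = ρ₁ * ρ₂ := by
    intro x y hxy
    rcases (hedge x y hxy).2 with ⟨h, h'⟩ | ⟨h, h'⟩ <;> rw [h, h']
    ring
  have hI : ∀ x y, IsPolygonEdge X x y → x.re * y.re + x.im * y.im = k := by
    intro x y hxy
    obtain ⟨h1, h2⟩ := hedge x y hxy
    have h4 : ‖x‖ ^ 2 + ‖y‖ ^ 2 = ρ₁ ^ 2 + ρ₂ ^ 2 := by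
      rcases h2 with ⟨h, h'⟩ | ⟨h, h'⟩ <;> rw [h, h']
      ring
    have h5 : ‖x - y‖ ^ 2 = ℓ ^ 2 := by rw [h1]
    simp only [Complex.sq_norm, Complex.normSq_apply, Complex.sub_re, Complex.sub_im] at h4 h5
    linarith
  have hL : ∀ x y, IsPolygonEdge X x y → k ^ 2 + cross x y ^ 2 = (ρ₁ * ρ₂) ^ 2 := by
    intro x y hxy
    rw [← hI x y hxy, ← hmul x y hxy, mul_pow, Complex.sq_norm, Complex.sq_norm,
      Complex.normSq_apply, Complex.normSq_apply]
    unfold cross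
    ring
  obtain ⟨x₀, hx₀, hx₀n⟩ : ∃ v ∈ X, ‖v‖ = ρ₂ := by
    obtain ⟨x, hx⟩ := Set.nonempty_of_ncard_ne_zero (s := X) (by omega)
    obtain ⟨y, hy⟩ := hnext x hx
    rcases (hedge x y hy).2 with ⟨-, h⟩ | ⟨h, -⟩
    · exact ⟨y, hy.2.1, h⟩
    · exact ⟨x, hx, h⟩
  choose! nxt hnxt using hnext
  -- the common angle of all edges
  obtain ⟨α, hα0, hαπ, hcos, hsin⟩ : ∃ α : ℝ, 0 < α ∧ α < Real.pi ∧ ρ₁ * ρ₂ * Real.cos α = k ∧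
      ∀ x y, IsPolygonEdge X x y → cross x y = ρ₁ * ρ₂ * Real.sin α := by
    have h0 := hL x₀ _ (hnxt x₀ hx₀)
    have h0' := hturn x₀ _ (hnxt x₀ hx₀)
    have habs : |k| < ρ₁ * ρ₂ := abs_lt_of_sq_lt_sq (by nlinarith) hρρ.le
    obtain ⟨h1, h2⟩ := abs_lt.1 habs
    have hlow : -1 < k / (ρ₁ * ρ₂) := by rw [lt_div_iff₀ hρρ]; linarith
    have hupp : k / (ρ₁ * ρ₂) < 1 := by rw [div_lt_one hρρ]; linarith
    have hc : ρ₁ * ρ₂ * Real.cos (Real.arccos (k / (ρ₁ * ρ₂))) = k := by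
      rw [Real.cos_arccos hlow.le hupp.le, mul_div_cancel₀ _ hρρ.ne']
    have hα0 := Real.arccos_pos.2 hupp
    have hαπ : Real.arccos (k / (ρ₁ * ρ₂)) < Real.pi := by
      refine lt_of_le_of_ne (Real.arccos_le_pi _) fun h => ?_
      rw [Real.arccos_eq_pi] at h
      linarith
    refine ⟨_, hα0, hαπ, hc, fun x y hxy => ?_⟩
    have hs := mul_pos hρρ (Real.sin_pos_of_pos_of_lt_pi hα0 hαπ)
    refine (sq_eq_sq₀ (hturn x y hxy).le hs.le).1 ?_
    have h5 := hL x y hxy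
    have h6 := Real.sin_sq_add_cos_sq (Real.arccos (k / (ρ₁ * ρ₂)))
    linear_combination h5 - (ρ₁ * ρ₂) ^ 2 * h6 +
      (ρ₁ * ρ₂ * Real.cos (Real.arccos (k / (ρ₁ * ρ₂))) + k) * hc
  have hn0 : ∀ x ∈ X, 0 < ‖x‖ := by
    intro x hx
    rcases (hedge x _ (hnxt x hx)).2 with ⟨h, -⟩ | ⟨h, -⟩ <;> rw [h] <;> assumption
  -- the vertices in cyclic order
  set ρ : ℕ → ℝ := fun j => if Even j then ρ₂ else ρ₁ with hρdef
  set s : ℕ → ℂ := fun j => nxt^[j] x₀ with hsdef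
  have hs_succ : ∀ j, s (j + 1) = nxt (s j) := fun j => Function.iterate_succ_apply' _ _ _
  have hsX : ∀ j, s j ∈ X := by
    intro j
    induction j with
    | zero => exact hx₀
    | succ j ih => rw [hs_succ]; exact (hnxt _ ih).2.1
  have hsE : ∀ j, IsPolygonEdge X (s j) (s (j + 1)) := fun j => by
    rw [hs_succ]; exact hnxt _ (hsX j)
  have hsn : ∀ j, ‖s j‖ = ρ j := by
    intro j
    induction j with
    | zero => simpa [hρdef, hsdef] using hx₀n
    | succ j ih =>
      have h := (hedge _ _ (hsE j)).2
      rw [ih] at h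
      simp only [hρdef, Nat.even_add_one] at h ⊢
      split_ifs at h ⊢ with hj
      · rcases h with h | h
        · exact absurd h.1 hρ.ne'
        · exact h.2
      · rcases h with h | h
        · exact h.2
        · exact absurd h.1 hρ.ne
  have hρpos : ∀ j, 0 < ρ j := fun j => hsn j ▸ hn0 _ (hsX j)
  obtain ⟨u, hu, hux⟩ : ∃ u : ℂ, ‖u‖ = 1 ∧ x₀ = ρ₂ * u := by
    have : (ρ₂ : ℂ) ≠ 0 := by exact_mod_cast hρ₂pos.ne'
    refine ⟨x₀ / ρ₂, ?_, by field_simp⟩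
    rw [norm_div, hx₀n, Complex.norm_real, Real.norm_of_nonneg hρ₂pos.le, div_self hρ₂pos.ne']
  have hs : ∀ j : ℕ, s j = ρ j * (u * Complex.exp ((j * α : ℝ) * Complex.I)) := by
    intro j
    induction j with
    | zero => simpa [hρdef, hsdef] using hux
    | succ j ih =>
      have h := norm_mul_eq_of_cross (α := α) ((hsin _ _ (hsE j)).trans (by rw [hmul _ _ (hsE j)]))
        ((hI _ _ (hsE j)).trans (by rw [hmul _ _ (hsE j), hcos])) (norm_pos_iff.1 (hn0 _ (hsX j)))
      rw [hsn, hsn, ih] at h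
      have hne : (ρ j : ℂ) ≠ 0 := by exact_mod_cast (hρpos j).ne'
      refine mul_left_cancel₀ hne (h.trans ?_)
      have : Complex.exp (((j + 1 : ℕ) * α : ℝ) * Complex.I) =
          Complex.exp ((j * α : ℝ) * Complex.I) * Complex.exp (α * Complex.I) := by
        rw [← Complex.exp_add]
        congr 1
        push_cast
        ring
      rw [this]
      ring
  have hsector : ∀ p ∈ X, ∀ θ : ℝ, 0 ≤ θ → p = ‖p‖ * (u * Complex.exp (θ * Complex.I)) →
      p = s ⌊θ / α⌋₊ ∧ θ = ⌊θ / α⌋₊ * α := by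
    intro p hp θ hθ hpθ
    have h1 : ⌊θ / α⌋₊ * α ≤ θ := (le_div_iff₀ hα0).1 (Nat.floor_le (by positivity))
    have h2 : θ < (⌊θ / α⌋₊ + 1) * α := (div_lt_iff₀ hα0).1 (Nat.lt_floor_add_one _)
    set j := ⌊θ / α⌋₊
    have h0 := hn0 p hp
    have hc1 : cross (s j) p = ρ j * ‖p‖ * Real.sin (θ - j * α) := by
      rw [hs j, ← cross_polar _ _ _ _ hu, ← hpθ]
    have hc2 : cross p (s (j + 1)) = ‖p‖ * ρ (j + 1) * Real.sin ((j + 1 : ℕ) * α - θ) := by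
      rw [hs (j + 1), ← cross_polar _ _ _ _ hu, ← hpθ]
    have hps : p = s j := by
      refine eq_of_mem_sector (fun x hx => ⟨_, hnxt x hx⟩) hturn (hsE j) hp ?_ ?_
      · rw [hc1]
        exact mul_nonneg (mul_pos (hρpos j) h0).le
          (Real.sin_nonneg_of_nonneg_of_le_pi (by linarith) (by linarith))
      · rw [hc2]
        refine mul_pos (mul_pos h0 (hρpos _)) (Real.sin_pos_of_pos_of_lt_pi ?_ ?_) <;>
          push_cast <;> linarith
    refine ⟨hps, ?_⟩
    by_contra hne
    have hlt : j * α < θ := lt_of_le_of_ne h1 (Ne.symm hne)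
    have : 0 < cross (s j) p := by
      rw [hc1]
      exact mul_pos (mul_pos (hρpos j) h0)
        (Real.sin_pos_of_pos_of_lt_pi (by linarith) (by linarith))
    rw [hps] at this
    simp [cross, mul_comm] at this
  have hangle : ∀ p ∈ X, ∃ θ : ℝ, 0 ≤ θ ∧ θ < 2 * Real.pi ∧
      p = ‖p‖ * (u * Complex.exp (θ * Complex.I)) := by
    intro p hp
    have hu0 : u ≠ 0 := norm_pos_iff.1 (by rw [hu]; exact one_pos)
    refine ⟨toIcoMod Real.two_pi_pos 0 (Complex.arg (p / u)), (toIcoMod_mem_Ico _ _ _).1,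
      by simpa using (toIcoMod_mem_Ico Real.two_pi_pos 0 (Complex.arg (p / u))).2, ?_⟩
    have h1 := Complex.norm_mul_exp_arg_mul_I (p / u)
    rw [norm_div, hu, div_one] at h1
    have h2 : Complex.exp ((toIcoMod Real.two_pi_pos 0 (Complex.arg (p / u)) : ℝ) * Complex.I) =
        Complex.exp (Complex.arg (p / u) * Complex.I) := by
      rw [Complex.exp_eq_exp_iff_exists_int]
      refine ⟨-toIcoDiv Real.two_pi_pos 0 (Complex.arg (p / u)), ?_⟩
      rw [toIcoMod]
      simp only [zsmul_eq_mul]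
      push_cast
      ring
    rw [h2, mul_left_comm, h1]
    field_simp
  obtain ⟨N, hN⟩ : ∃ N : ℕ, 2 * Real.pi = N * α := by
    refine ⟨_, (hsector x₀ hx₀ (2 * Real.pi) Real.two_pi_pos.le ?_).2⟩
    rw [hx₀n, hux]
    have : ((2 * Real.pi : ℝ) : ℂ) * Complex.I = 2 * Real.pi * Complex.I := by push_cast; ring
    rw [this, Complex.exp_two_pi_mul_I, mul_one]
  have hXs : X = s '' Set.Iio N := by
    ext p
    constructor
    · intro hp
      obtain ⟨θ, h1, h2, h4⟩ := hangle p hp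
      obtain ⟨h5, h6⟩ := hsector p hp θ h1 h4
      refine ⟨_, ?_, h5.symm⟩
      rw [hN] at h2
      rw [h6] at h2
      exact_mod_cast lt_of_mul_lt_mul_right h2 hα0.le
    · rintro ⟨j, -, rfl⟩
      exact hsX j
  have hinj : Set.InjOn s (Set.Iio N) := by
    intro i hi j hj hij
    have h1 : (s i) = ‖s j‖ * (u * Complex.exp ((i * α : ℝ) * Complex.I)) := by
      rw [← hij, hsn]; exact hs i
    have h2 : (s j) = ‖s j‖ * (u * Complex.exp ((j * α : ℝ) * Complex.I)) := by
      rw [hsn]; exact hs j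
    have h4 := (h1.symm.trans hij).trans h2
    have hu0 : u ≠ 0 := norm_pos_iff.1 (by rw [hu]; exact one_pos)
    have hne : (‖s j‖ : ℂ) ≠ 0 := by exact_mod_cast (hn0 _ (hsX j)).ne'
    have h5 := mul_left_cancel₀ hu0 (mul_left_cancel₀ hne h4)
    rw [Complex.exp_eq_exp_iff_exists_int] at h5
    obtain ⟨n, hn⟩ := h5
    have h6 : (i : ℝ) * α = j * α + n * (N * α) := by
      rw [← hN]
      have : (((i * α : ℝ)) : ℂ) * Complex.I = ((j * α + n * (2 * Real.pi) : ℝ) : ℂ) * Complex.I := by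
        rw [hn]; push_cast; ring
      exact_mod_cast mul_right_cancel₀ Complex.I_ne_zero this
    have h7 : (i : ℤ) = j + n * N := by
      have : (i : ℝ) = j + n * N := mul_right_cancel₀ hα0.ne' (by rw [h6]; ring)
      exact_mod_cast this
    have hi' : (i : ℤ) < N := by exact_mod_cast hi
    have hj' : (j : ℤ) < N := by exact_mod_cast hj
    have hn0 : n = 0 := by
      have a1 : n < 1 := by
        by_contra h; push Not at h; nlinarith
      have a2 : -1 < n := by
        by_contra h; push Not at h; nlinarith
      omega
    rw [hn0] at h7
    simpa using h7
  have hcard : X.ncard = N := by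
    rw [hXs, hinj.ncard_image, Set.ncard_Iio_nat]
  have hN0 : (N : ℝ) ≠ 0 := by
    rw [← hcard]
    exact_mod_cast (by omega : X.ncard ≠ 0)
  have hα : α = 2 * Real.pi / N := by
    rw [hN, mul_div_cancel_left₀ _ hN0]
  refine ⟨hρ₁pos, ?_, by linarith, u, hu, ?_⟩
  · rw [hcard, ← hα]
    linarith
  · rw [hcard, alternatingVertices, Set.image_image, ← hα]
    conv_lhs => rw [hXs]
    refine Set.image_congr fun j _ => ?_
    rw [hs]
    ring

/-- The radii of the polygons are determined by the edge length and the number of vertices. -/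
lemma radii_unique {a b a' b' C m : ℝ} (ha : 0 < a) (ha' : 0 < a') (hab : a < b) (hab' : a' < b')
    (hD : b ^ 2 - a ^ 2 = b' ^ 2 - a' ^ 2)
    (h : a ^ 2 + b ^ 2 - 2 * a * b * C = m) (h' : a' ^ 2 + b' ^ 2 - 2 * a' * b' * C = m)
    (hC : 2 * a * b * C < 2 * a ^ 2) : a = a' := by
  have h1 : b * C < a := by nlinarith [hC]
  have h2 : b' * C < a' := by nlinarith
  set A := a + a' with hA
  set B := b + b' with hB
  have hA0 : 0 < A := by positivity
  have hB0 : 0 < B := by linarith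
  have hAB : A < B := by linarith
  have hCB : C * B < A := by linarith
  have key : (a - a') * (4 * A * B - 2 * C * (A ^ 2 + B ^ 2)) = 0 := by
    have e1 : (b - b') * B = (a - a') * A := by rw [hA, hB]; linarith
    have e2 : 2 * (a - a') * A = 2 * C * (a * b - a' * b') := by
      rw [hA]; linear_combination h - h' - hD
    have e3 : 2 * (a * b - a' * b') = (a - a') * B + (b - b') * A := by rw [hA, hB]; ring
    linear_combination 2 * B * e2 + 2 * C * B * e3 + 2 * C * A * e1
  rcases mul_eq_zero.1 key with h0 | h0
  · linarith
  · exfalso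
    have t1 : C * B ^ 2 < A * B := by nlinarith
    have t2 : C * A ^ 2 < A * B := by
      rcases le_or_gt C 0 with hc | hc
      · nlinarith [mul_pos hA0 hB0, sq_nonneg A]
      · have : C < 1 := by nlinarith
        nlinarith [mul_pos hA0 hB0, sq_nonneg A]
    linarith

/-- The segment between consecutive vertices of a plane polygon is an exposed face. -/
lemma isExposed_segment_of_isPolygonEdge {E : Type*} [NormedAddCommGroup E]
    [InnerProductSpace ℝ E] {F : Set E} (hcomp : IsCompact F) (hconv : Convex ℝ F)
    (hF : convexHull ℝ (Set.extremePoints ℝ F) = F) (c : E) (L : ℂ →ₗᵢ[ℝ] E)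
    (hL : ∀ p ∈ F, ∃ z, p = c + L z) {x y : ℂ}
    (hxy : IsPolygonEdge {z | c + L z ∈ Set.extremePoints ℝ F} x y) :
    IsExposed ℝ F (segment ℝ (c + L x) (c + L y)) := by
  set l : E →L[ℝ] ℝ := -innerSL ℝ (L (Complex.I * (y - x))) with hl
  have hlz : ∀ z, l (c + L z) = l (c + L x) - cross (y - x) (z - x) := by
    intro z
    simp only [hl, neg_apply, innerSL_apply_apply, inner_add_right, LinearIsometry.inner_map_map,
      Complex.inner, cross]
    simp
    ring
  have hxF : c + L x ∈ F := hxy.1.1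
  have hyF : c + L y ∈ F := hxy.2.1.1
  have hlxy : l (c + L y) = l (c + L x) := by
    rw [hlz y]
    simp [cross, mul_comm]
  have hmax : ∀ p ∈ F, l p ≤ l (c + L x) := by
    have hsub : convexHull ℝ (Set.extremePoints ℝ F) ⊆ {p | l p ≤ l (c + L x)} := by
      refine convexHull_min (fun p hp => ?_) (convex_halfSpace_le l.toLinearMap.isLinear _)
      obtain ⟨z, rfl⟩ := hL p hp.1
      change l (c + L z) ≤ l (c + L x)
      by_cases hzx : z = x
      · rw [hzx]
      by_cases hzy : z = y
      · rw [hzy, hlxy]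
      have := hxy.2.2.2 z hp hzx hzy
      rw [hlz]
      linarith
    rw [hF] at hsub
    exact hsub
  have hexp : IsExposed ℝ F (l.toExposed F) := ContinuousLinearMap.toExposed.isExposed
  have hG : segment ℝ (c + L x) (c + L y) = l.toExposed F := by
    apply Set.Subset.antisymm
    · exact (hexp.convex hconv).segment_subset ⟨hxF, hmax⟩ ⟨hyF, by rw [hlxy]; exact hmax⟩
    · rw [← closure_convexHull_extremePoints (hexp.isCompact hcomp) (hexp.convex hconv)]
      refine closure_minimal (convexHull_min (fun p hp => ?_) (convex_segment _ _)) ?_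
      · have hpF := hexp.isExtreme.extremePoints_subset_extremePoints hp
        obtain ⟨z, rfl⟩ := hL p hpF.1
        by_cases hzx : z = x
        · rw [hzx]
          exact left_mem_segment _ _ _
        by_cases hzy : z = y
        · rw [hzy]
          exact right_mem_segment _ _ _
        have h1 := hxy.2.2.2 z hpF hzx hzy
        have h2 := hp.1.2 _ hxF
        rw [hlz z] at h2
        linarith
      · rw [← convexHull_pair]
        exact (Set.toFinite _).isClosed_convexHull ℝ
  rw [hG]
  exact hexp

lemma three_le_ncard_of_finrank_direction {E : Type*} [AddCommGroup E] [Module ℝ E] {V : Set E}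
    (hV : V.Finite) (h : Module.finrank ℝ (vectorSpan ℝ V) = 2) : 3 ≤ V.ncard := by
  by_contra! hlt
  have hcol : Collinear ℝ V := by
    have : V.ncard = 0 ∨ V.ncard = 1 ∨ V.ncard = 2 := by omega
    rcases this with h0 | h1 | h2
    · rw [Set.ncard_eq_zero hV] at h0
      rw [h0]
      exact collinear_empty ℝ E
    · obtain ⟨a, rfl⟩ := Set.ncard_eq_one.1 h1
      exact collinear_singleton ℝ a
    · obtain ⟨a, b, -, rfl⟩ := Set.ncard_eq_two.1 h2
      exact collinear_pair ℝ a b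
  have : FiniteDimensional ℝ (vectorSpan ℝ V) := Module.finite_of_finrank_pos (by omega)
  have := collinear_iff_finrank_le_one.1 hcol
  omega

/-- Every two-dimensional face is, in suitable coordinates of its plane centred at the foot `c` of
the perpendicular from the origin, a polygon with alternating radii. -/
theorem exists_face_coordinates {P V1 V2 : Set (Euc 3)} {r1 r2 ℓ : ℝ} (hP : IsPolytope P)
    (hbip : IsBipartiteWith P V1 V2 r1 r2 ℓ) (hstrict : r1 < r2) {F : Set (Euc 3)}
    (hF : IsExposed ℝ P F) (hdim : Module.finrank ℝ (affineSpan ℝ F).direction = 2)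
    (hfin : (Set.extremePoints ℝ F).Finite) :
    ∃ (c : Euc 3) (L : ℂ →ₗᵢ[ℝ] Euc 3) (ρ₁ ρ₂ : ℝ),
      convexHull ℝ (Set.extremePoints ℝ F) = F ∧
      Metric.infDist 0 (affineSpan ℝ F : Set (Euc 3)) = ‖c‖ ∧
      0 < ρ₁ ∧ ρ₁ < ρ₂ ∧ ρ₁ ^ 2 = r1 ^ 2 - ‖c‖ ^ 2 ∧ ρ₂ ^ 2 = r2 ^ 2 - ‖c‖ ^ 2 ∧
      2 * ρ₁ * ρ₂ * Real.cos (2 * Real.pi / (Set.extremePoints ℝ F).ncard) =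
        ρ₁ ^ 2 + ρ₂ ^ 2 - ℓ ^ 2 ∧
      ρ₁ ^ 2 + ρ₂ ^ 2 - ℓ ^ 2 < 2 * ρ₁ ^ 2 ∧
      Set.extremePoints ℝ F =
        (fun z => c + L z) '' alternatingVertices (Set.extremePoints ℝ F).ncard ρ₁ ρ₂ := by
  obtain ⟨S, rfl⟩ := hP
  obtain ⟨hℓ, hlen, -, -, hpart, hr1, -, hn1, hn2⟩ := hbip
  have hcomp : IsCompact F := hF.isCompact (S.finite_toSet.isCompact_convexHull ℝ)
  have hconv : Convex ℝ F := hF.convex (convex_convexHull ℝ _)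
  have hKM : convexHull ℝ (Set.extremePoints ℝ F) = F := by
    rw [← (hfin.isClosed_convexHull ℝ).closure_eq]
    exact closure_convexHull_extremePoints hcomp hconv
  have h3 : 3 ≤ (Set.extremePoints ℝ F).ncard := by
    refine three_le_ncard_of_finrank_direction hfin ?_
    rw [← direction_affineSpan, ← affineSpan_convexHull, hKM]
    exact hdim
  have hFne : F.Nonempty :=
    (Set.nonempty_of_ncard_ne_zero (s := Set.extremePoints ℝ F) (by omega)).mono
      extremePoints_subset
  have : Nonempty (affineSpan ℝ F) := ((affineSpan_nonempty ℝ).2 hFne).to_subtype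
  -- the foot of the perpendicular and coordinates on the plane
  set D := (affineSpan ℝ F).direction with hD
  set c : Euc 3 := ↑(EuclideanGeometry.orthogonalProjection (affineSpan ℝ F) (0 : Euc 3))
  have hcmem : c ∈ affineSpan ℝ F := EuclideanGeometry.orthogonalProjection_mem _
  have hcperp : ∀ v ∈ D, inner ℝ c v = 0 := by
    intro v hv
    have := EuclideanGeometry.orthogonalProjection_vsub_mem_direction_orthogonal
      (affineSpan ℝ F) (0 : Euc 3)
    rw [vsub_eq_sub, sub_zero] at this
    rw [real_inner_comm]
    exact (Submodule.mem_orthogonal _ _).1 this v hv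
  have hdist : Metric.infDist 0 (affineSpan ℝ F : Set (Euc 3)) = ‖c‖ := by
    rw [← EuclideanGeometry.dist_orthogonalProjection_eq_infDist, dist_zero_left]
  set e : ℂ ≃ₗᵢ[ℝ] D := Complex.orthonormalBasisOneI.repr.trans
    ((stdOrthonormalBasis ℝ D).reindex (finCongr hdim)).repr.symm
  set L : ℂ →ₗᵢ[ℝ] Euc 3 := D.subtypeₗᵢ.comp e.toLinearIsometry with hLdef
  have hLD : ∀ z, L z ∈ D := fun z => (e z).2
  have hL : ∀ p ∈ F, ∃ z, p = c + L z := by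
    intro p hp
    have hpD : p - c ∈ D :=
      AffineSubspace.vsub_mem_direction (subset_affineSpan ℝ F hp) hcmem
    refine ⟨e.symm ⟨p - c, hpD⟩, ?_⟩
    simp [hLdef]
  have hnorm : ∀ z, ‖c + L z‖ ^ 2 = ‖c‖ ^ 2 + ‖z‖ ^ 2 := by
    intro z
    rw [norm_add_sq_real, hcperp _ (hLD z), L.norm_map]
    ring
  set X : Set ℂ := {z | c + L z ∈ Set.extremePoints ℝ F} with hX
  have hφinj : Function.Injective fun z => c + L z := fun z w h =>
    L.injective (add_left_cancel h)
  have hφX : (fun z => c + L z) '' X = Set.extremePoints ℝ F := by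
    ext p
    constructor
    · rintro ⟨z, hz, rfl⟩
      exact hz
    · intro hp
      obtain ⟨z, rfl⟩ := hL p hp.1
      exact ⟨z, hp, rfl⟩
  have hXcard : X.ncard = (Set.extremePoints ℝ F).ncard := by
    rw [← hφX, Set.ncard_image_of_injective _ hφinj]
  have hXfin : X.Finite := hfin.preimage hφinj.injOn
  have hXconv : ∀ x ∈ X, x ∉ convexHull ℝ (X \ {x}) := by
    intro x hx hmem
    refine (hconv.mem_extremePoints_iff_mem_sdiff_convexHull_sdiff.1 hx).2 ?_
    set φ : ℂ →ᵃ[ℝ] Euc 3 := AffineMap.const ℝ ℂ c + L.toLinearMap.toAffineMap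
    have h1 : φ x ∈ φ '' convexHull ℝ (X \ {x}) := Set.mem_image_of_mem _ hmem
    rw [AffineMap.image_convexHull] at h1
    refine convexHull_mono ?_ h1
    rintro _ ⟨z, ⟨hz, hzx⟩, rfl⟩
    exact ⟨extremePoints_subset hz, fun h => hzx (hφinj h)⟩
  have hex : ∀ x ∈ X, ∃ x' ∈ X, x' ≠ x := fun x hx =>
    Set.exists_ne_of_one_lt_ncard (by omega) x
  have hnext : ∀ x ∈ X, ∃ y, IsPolygonEdge X x y := fun x hx => by
    obtain ⟨x', hx', hne⟩ := hex x hx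
    exact exists_next_of_convexPosition hXfin hXconv hx hx' hne
  have hprev : ∀ x ∈ X, ∃ z, IsPolygonEdge X z x := fun x hx => by
    obtain ⟨x', hx', hne⟩ := hex x hx
    exact exists_prev_of_convexPosition hXfin hXconv hx hx' hne
  have hPedge : ∀ x y, IsPolygonEdge X x y →
      IsEdge (convexHull ℝ (S : Set (Euc 3))) (c + L x) (c + L y) := fun x y hxy =>
    ⟨fun h => hxy.2.2.1 (hφinj h), isExposed_convexHull_trans S hF
      (isExposed_segment_of_isPolygonEdge hcomp hconv hKM c L hL hxy)⟩
  have hradii : ∀ x y, IsPolygonEdge X x y →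
      (‖c + L x‖ = r1 ∧ ‖c + L y‖ = r2) ∨ (‖c + L x‖ = r2 ∧ ‖c + L y‖ = r1) := by
    intro x y hxy
    rcases hpart _ _ (hPedge x y hxy) with ⟨h1, h2⟩ | ⟨h1, h2⟩
    · exact Or.inl ⟨hn1 _ h1, hn2 _ h2⟩
    · exact Or.inr ⟨hn2 _ h1, hn1 _ h2⟩
  have hsqrt : ∀ z, ‖z‖ = √(‖c + L z‖ ^ 2 - ‖c‖ ^ 2) := by
    intro z
    rw [hnorm, add_sub_cancel_left, Real.sqrt_sq (norm_nonneg _)]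
  have hnn : 0 ≤ r1 ^ 2 - ‖c‖ ^ 2 := by
    obtain ⟨x, hx⟩ := Set.nonempty_of_ncard_ne_zero (s := X) (by omega)
    obtain ⟨y, hy⟩ := hnext x hx
    rcases hradii x y hy with ⟨h, -⟩ | ⟨-, h⟩
    · rw [← h, hnorm, add_sub_cancel_left]; positivity
    · rw [← h, hnorm, add_sub_cancel_left]; positivity
  have hr : r1 ^ 2 - ‖c‖ ^ 2 < r2 ^ 2 - ‖c‖ ^ 2 := by nlinarith
  have hedge : ∀ x y, IsPolygonEdge X x y → ‖x - y‖ = ℓ ∧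
      ((‖x‖ = √(r1 ^ 2 - ‖c‖ ^ 2) ∧ ‖y‖ = √(r2 ^ 2 - ‖c‖ ^ 2)) ∨
        (‖x‖ = √(r2 ^ 2 - ‖c‖ ^ 2) ∧ ‖y‖ = √(r1 ^ 2 - ‖c‖ ^ 2))) := by
    intro x y hxy
    constructor
    · have := hlen _ _ (hPedge x y hxy)
      rwa [add_sub_add_left_eq_sub, ← map_sub, L.norm_map] at this
    · rw [hsqrt x, hsqrt y]
      rcases hradii x y hxy with ⟨h1, h2⟩ | ⟨h1, h2⟩ <;> rw [h1, h2] <;> simp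
  have hρ := Real.sqrt_lt_sqrt hnn hr
  obtain ⟨hpos, hcos, hacute, u, hu, hXu⟩ := eq_image_alternatingVertices (Real.sqrt_nonneg _) hρ
    (by omega) hnext hprev hedge
  rw [hXcard] at hcos hXu
  refine ⟨c, L.comp (rotation ⟨u, mem_sphere_zero_iff_norm.2 hu⟩).toLinearIsometry, _, _, hKM,
    hdist, hpos, hρ, Real.sq_sqrt hnn, Real.sq_sqrt (hnn.trans hr.le), hcos, hacute, ?_⟩
  conv_lhs => rw [← hφX, hXu, Set.image_image]
  rfl

/-- In a full-dimensional strictly bipartite polyhedron `P ⊆ ℝ³`, any two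
2-dimensional exposed faces with the same number of vertices are congruent, and their
affine spans have the same distance from the origin. -/
theorem congruent_faces_of_strictlyBipartite
    (P V1 V2 : Set (Euc 3)) (r1 r2 ℓ : ℝ)
    (hP : IsPolytope P) (hfull : FullDim P)
    (hbip : IsBipartiteWith P V1 V2 r1 r2 ℓ) (hstrict : r1 < r2)
    (F1 F2 : Set (Euc 3)) (hF1 : IsExposed ℝ P F1) (hF2 : IsExposed ℝ P F2)
    (hdim1 : Module.finrank ℝ (affineSpan ℝ F1).direction = 2)
    (hdim2 : Module.finrank ℝ (affineSpan ℝ F2).direction = 2)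
    (hfin1 : (Set.extremePoints ℝ F1).Finite) (hfin2 : (Set.extremePoints ℝ F2).Finite)
    (hcard : (Set.extremePoints ℝ F1).ncard = (Set.extremePoints ℝ F2).ncard) :
    (∃ T : Euc 3 ≃ᵢ Euc 3, T '' F1 = F2) ∧
    Metric.infDist 0 (affineSpan ℝ F1 : Set (Euc 3)) =
      Metric.infDist 0 (affineSpan ℝ F2 : Set (Euc 3)) := by
  obtain ⟨c, L, a, b, hF, hd, ha, hab, ha2, hb2, hcos, hacute, hV⟩ :=
    exists_face_coordinates hP hbip hstrict hF1 hdim1 hfin1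
  obtain ⟨c', L', a', b', hF', hd', ha', hab', ha2', hb2', hcos', -, hV'⟩ :=
    exists_face_coordinates hP hbip hstrict hF2 hdim2 hfin2
  rw [hcard] at hcos hV
  have haa : a = a' := radii_unique ha ha' hab hab' (by linarith)
    (by rw [hcos]; ring : _ = ℓ ^ 2) (by rw [hcos']; ring) (by rwa [hcos])
  have hcc : ‖c‖ = ‖c'‖ := by
    refine (sq_eq_sq₀ (norm_nonneg _) (norm_nonneg _)).1 ?_
    rw [haa] at ha2
    linarith
  have hbb : b = b' := by
    refine (sq_eq_sq₀ (ha.trans hab).le (ha'.trans hab').le).1 ?_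
    rw [hb2, hb2', hcc]
  refine ⟨?_, by rw [hd, hd', hcc]⟩
  subst haa hbb
  set R : Euc 3 ≃ₗᵢ[ℝ] Euc 3 :=
    ((L'.comp L.equivRange.symm.toLinearIsometry).extend).toLinearIsometryEquiv rfl with hR
  have hRL : ∀ z, R (L z) = L' z := by
    intro z
    have h := LinearIsometry.extend_apply (L'.comp L.equivRange.symm.toLinearIsometry)
      (L.equivRange z)
    have h2 : (L'.comp L.equivRange.symm.toLinearIsometry) (L.equivRange z) = L' z := by simp
    rw [h2] at h
    exact h
  refine ⟨(IsometryEquiv.subRight c).trans (R.toIsometryEquiv.trans (IsometryEquiv.addRight c')),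
    ?_⟩
  set A : Euc 3 →ᵃ[ℝ] Euc 3 := R.toLinearEquiv.toLinearMap.toAffineMap +
    AffineMap.const ℝ (Euc 3) (c' - R c) with hA
  have hTA : ⇑((IsometryEquiv.subRight c).trans
      (R.toIsometryEquiv.trans (IsometryEquiv.addRight c'))) = ⇑A := by
    funext x
    simp [hA]
    abel
  rw [hTA]
  conv_lhs => rw [← hF, AffineMap.image_convexHull, hV, Set.image_image]
  conv_rhs => rw [← hF', hV']
  congr 1
  refine Set.image_congr fun z _ => ?_
  simp [hA, hRL]
  abel
end
end

section
/- Let P ⊆ ℝ³ be a full-dimensional strictly bipartite convex polytope with vertex partition V1, V2 and radii r1 < r2. Then every vertex v ∈ V1 (i.e. with ‖v‖ = r1) is contained in exactly three edges of P. -/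
open Set Pointwise

noncomputable section

open scoped NNReal

/-- Every point of a polytope lies in the cone spanned at a vertex by the edges through it. -/
theorem IsPolytope.sub_mem_span_edges {d : ℕ} {P : Set (Euc d)} (hP : IsPolytope P)
    {x : Euc d} (hx : x ∈ P.extremePoints ℝ) {y : Euc d} (hy : y ∈ P) :
    y - x ∈ Submodule.span ℝ≥0 {d | IsEdge P x (x + d)} := by
  classical
  obtain ⟨S, hS⟩ := hP
  have hPc : Convex ℝ P := hS ▸ convex_convexHull ℝ _
  have hPk : IsCompact P := hS ▸ S.finite_toSet.isCompact_convexHull ℝ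
  have hext : P.extremePoints ℝ ⊆ S := by
    rw [hS]; exact extremePoints_convexHull_subset
  have hfin : (P.extremePoints ℝ).Finite := S.finite_toSet.subset hext
  have hhull : convexHull ℝ (P.extremePoints ℝ) = P := by
    rw [← (hfin.isClosed_convexHull ℝ).closure_eq]
    exact closure_convexHull_extremePoints hPk hPc
  set c : Finset (Euc d) → Submodule ℝ≥0 (Euc d) :=
    fun T => Submodule.span ℝ≥0 ((· - x) '' (T : Set (Euc d))) with hc
  have hconv : ∀ K : Submodule ℝ≥0 (Euc d), Convex ℝ (K : Set (Euc d)) := by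
    intro K a ha b hb s t hs ht _
    exact K.add_mem (K.smul_mem ⟨s, hs⟩ ha) (K.smul_mem ⟨t, ht⟩ hb)
  have hconv' : ∀ K : Submodule ℝ≥0 (Euc d), Convex ℝ {z | z - x ∈ K} := by
    intro K
    exact (hconv K).affine_preimage (AffineMap.id ℝ (Euc d) - AffineMap.const ℝ (Euc d) x)
  -- a minimal set of vertices generating the cone
  obtain ⟨T, hT⟩ : ∃ T, Minimal (fun T : Finset (Euc d) =>
      (T : Set (Euc d)) ⊆ P.extremePoints ℝ \ {x} ∧ ∀ y ∈ P, y - x ∈ c T) T := by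
    apply exists_minimal_of_wellFoundedLT
    refine ⟨hfin.toFinset.erase x, ?_, ?_⟩
    · intro z; simp
    · intro y hy
      rw [← hhull] at hy
      refine convexHull_min ?_ (hconv' (c (hfin.toFinset.erase x))) hy
      intro z hz
      by_cases hzx : z = x
      · simp [hzx]
      · exact Submodule.subset_span ⟨z, by simp [hzx, hz], rfl⟩
  obtain ⟨⟨hTsub, hTgen⟩, hTmin⟩ := hT
  refine Submodule.span_mono ?_ (hTgen y hy)
  rintro _ ⟨t, ht, rfl⟩
  rw [Set.mem_ofPred_eq, add_sub_cancel]
  obtain ⟨htP, htx⟩ := hTsub ht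
  have htx : t ≠ x := htx
  have hTt : (T.erase t : Set (Euc d)) ⊆ P := fun s hs =>
    (hTsub (Finset.mem_of_mem_erase hs)).1.1
  have hcT : ∀ z, z ∈ c T → ∃ a : ℝ≥0, ∃ w ∈ c (T.erase t), z = a • (t - x) + w := by
    intro z hz
    have : c T = Submodule.span ℝ≥0
        (insert (t - x) ((· - x) '' ((T.erase t : Finset _) : Set (Euc d)))) := by
      rw [← image_insert_eq (f := (· - x)), ← Finset.coe_insert, Finset.insert_erase ht]
    rw [this, Submodule.mem_span_insert] at hz
    exact hz
  have hnot : t - x ∉ c (T.erase t) := by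
    intro h
    have := hTmin (y := T.erase t) ⟨fun s hs => hTsub (Finset.mem_of_mem_erase hs), ?_⟩
      (Finset.erase_subset t T) ht
    · simp at this
    · intro y hy
      obtain ⟨a, w, hw, h'⟩ := hcT _ (hTgen y hy)
      rw [h']
      exact add_mem (Submodule.smul_mem _ _ h) hw
  -- separate the line through the edge from the other generators
  have hdisj : Disjoint (convexHull ℝ ((· - x) '' ((T.erase t : Finset _) : Set (Euc d))))
      (Submodule.span ℝ {t - x} : Set (Euc d)) := by
    rw [Set.disjoint_left]
    intro w hw hw'
    have hwc : w ∈ c (T.erase t) :=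
      convexHull_min Submodule.subset_span (hconv (c (T.erase t))) hw
    have hwP : x + w ∈ convexHull ℝ ((T.erase t : Finset _) : Set (Euc d)) := by
      have h1 : Convex ℝ {z | x + z ∈ convexHull ℝ ((T.erase t : Finset _) : Set (Euc d))} :=
        (convex_convexHull ℝ _).translate_preimage_right x
      refine convexHull_min ?_ h1 hw
      rintro _ ⟨s, hs, rfl⟩
      simpa using subset_convexHull ℝ _ hs
    have hsubP := convexHull_min hTt hPc
    obtain ⟨μ, rfl⟩ := Submodule.mem_span_singleton.1 hw'
    rcases lt_trichotomy μ 0 with hμ | rfl | hμ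
    · have : x ∈ openSegment ℝ t (x + μ • (t - x)) := by
        have h1 : (0:ℝ) < 1 - μ := by linarith
        refine ⟨-μ / (1 - μ), 1 / (1 - μ), div_pos (by linarith) h1, by positivity,
          by field_simp; ring, ?_⟩
        have : (1 - μ) ≠ 0 := h1.ne'
        match_scalars <;> (field_simp; ring)
      exact htx (hx.2 htP.1 (hsubP hwP) this)
    · simp only [zero_smul, add_zero] at hwP
      have := extremePoints_convexHull_subset
        (inter_extremePoints_subset_extremePoints_of_subset hsubP ⟨hwP, hx⟩)
      exact (hTsub (Finset.mem_of_mem_erase this)).2 rfl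
    · apply hnot
      have := (c (T.erase t)).smul_mem (⟨μ⁻¹, by positivity⟩ : ℝ≥0) hwc
      convert this using 1
      change _ = μ⁻¹ • μ • (t - x)
      rw [inv_smul_smul₀ hμ.ne']
  obtain ⟨f, u, v, hfu, huv, hfv⟩ := geometric_hahn_banach_compact_closed
    (convex_convexHull ℝ _) (((T.erase t).finite_toSet.image (· - x)).isCompact_convexHull ℝ)
    (Submodule.span ℝ {t - x}).convex (Submodule.closed_of_finiteDimensional _) hdisj
  have hv0 : v < 0 := by simpa using hfv 0 (Submodule.zero_mem _)
  have hft : f (t - x) = 0 := by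
    by_contra hne
    have := hfv ((v / f (t - x)) • (t - x)) (Submodule.smul_mem _ _
      (Submodule.mem_span_singleton_self _))
    rw [map_smul, smul_eq_mul, div_mul_cancel₀ _ hne] at this
    exact lt_irrefl _ this
  have hfneg : ∀ w ∈ c (T.erase t), f w < 0 ∨ w = 0 := by
    intro w hw
    induction hw using Submodule.span_induction with
    | mem w hw => exact Or.inl ((hfu w (subset_convexHull ℝ _ hw)).trans (huv.trans hv0))
    | zero => exact Or.inr rfl
    | add a b _ _ ha hb =>
      rcases ha with ha | rfl
      · rcases hb with hb | rfl
        · left; rw [map_add]; linarith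
        · left; simpa using ha
      · simpa using hb
    | smul a w _ hw =>
      rcases hw with hw | rfl
      · rcases eq_or_lt_of_le a.2 with ha | ha
        · right
          have : a = 0 := by ext; exact ha.symm
          simp [this]
        · left
          change f ((a : ℝ) • w) < 0
          rw [map_smul, smul_eq_mul]
          exact mul_neg_of_pos_of_neg ha hw
      · simp
  have hP' : ∀ z ∈ P, f z < f x ∨ ∃ a : ℝ≥0, z = x + (a : ℝ) • (t - x) := by
    intro z hz
    obtain ⟨a, w, hw, h⟩ := hcT _ (hTgen z hz)
    have h' : z = x + (a : ℝ) • (t - x) + w := by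
      rw [add_assoc, ← sub_eq_iff_eq_add']; exact h
    rcases hfneg w hw with hw | rfl
    · left
      rw [h', map_add, map_add, map_smul, hft]
      simp only [smul_zero]; linarith
    · right; exact ⟨a, by simpa using h'⟩
  have hfline : ∀ a : ℝ, f (x + a • (t - x)) = f x := by
    intro a; rw [map_add, map_smul, hft]; simp
  have hle : ∀ z ∈ P, f z ≤ f x := by
    intro z hz
    rcases hP' z hz with h | ⟨a, rfl⟩
    · exact h.le
    · exact (hfline _).le
  refine ⟨htx.symm, fun _ => ⟨f, ?_⟩⟩
  ext z
  constructor
  · intro hz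
    refine ⟨hPc.segment_subset hx.1 htP.1 hz, fun y hy => ?_⟩
    rw [segment_eq_image'] at hz
    obtain ⟨a, -, rfl⟩ := hz
    rw [hfline]
    exact hle y hy
  · rintro ⟨hz, hmax⟩
    rcases hP' z hz with h | ⟨a, rfl⟩
    · exact absurd (hmax x hx.1) (not_le.2 h)
    · rw [segment_eq_image']
      refine ⟨a, ⟨a.2, ?_⟩, rfl⟩
      by_contra! h1
      have : t ∈ openSegment ℝ x (x + (a : ℝ) • (t - x)) := by
        have h0 : (0:ℝ) < a := by linarith
        refine ⟨1 - 1 / a, 1 / a, ?_, by positivity, by ring, ?_⟩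
        · rw [sub_pos, div_lt_one h0]; exact h1
        · match_scalars <;> field_simp
          ring
      exact htx (htP.2 hx.1 hz this).symm

/-- Every point of a face of a polytope lies in the cone spanned at a vertex by the edges
of that face through it. -/
theorem IsPolytope.sub_mem_span_edges_of_face {d : ℕ} {P : Set (Euc d)} (hP : IsPolytope P)
    {f : Euc d →ₗ[ℝ] ℝ} {M : ℝ} (hf : ∀ z ∈ P, f z ≤ M)
    {x : Euc d} (hx : x ∈ P.extremePoints ℝ) (hfx : f x = M) {y : Euc d} (hy : y ∈ P)
    (hfy : f y = M) :
    y - x ∈ Submodule.span ℝ≥0 {d | IsEdge P x (x + d) ∧ f (x + d) = M} := by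
  have key : ∀ z ∈ Submodule.span ℝ≥0 {d | IsEdge P x (x + d)},
      f z < 0 ∨ f z = 0 ∧ z ∈ Submodule.span ℝ≥0 {d | IsEdge P x (x + d) ∧ f (x + d) = M} := by
    intro z hz
    induction hz using Submodule.span_induction with
    | mem w hw =>
      have hw : IsEdge P x (x + w) := hw
      have : x + w ∈ P := hw.2.subset (right_mem_segment ℝ _ _)
      have h1 := hf _ this
      rw [map_add] at h1
      rcases h1.lt_or_eq with h | h
      · left; linarith
      · right
        refine ⟨by linarith, Submodule.subset_span ⟨hw, by rw [map_add]; exact h⟩⟩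
    | zero => right; simp
    | add a b _ _ ha hb =>
      rw [map_add]
      rcases ha with ha | ⟨ha, ha'⟩
      · left; rcases hb with hb | ⟨hb, -⟩ <;> linarith
      · rcases hb with hb | ⟨hb, hb'⟩
        · left; linarith
        · right; exact ⟨by linarith, add_mem ha' hb'⟩
    | smul a w _ hw =>
      have e : f (a • w) = a * f w := by
        change f ((a : ℝ) • w) = _
        rw [map_smul, smul_eq_mul]
      rw [e]
      rcases eq_or_lt_of_le a.2 with ha | ha
      · right
        have : a = 0 := by ext; exact ha.symm
        simp [this]
      · rcases hw with hw | ⟨hw, hw'⟩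
        · left; exact mul_neg_of_pos_of_neg ha hw
        · right; exact ⟨by simp [hw], Submodule.smul_mem _ _ hw'⟩
  rcases key _ (hP.sub_mem_span_edges hx hy) with h | h
  · rw [map_sub] at h; linarith
  · exact h.2

/-- In three-space, two distinct vectors of equal length in the plane `nᗮ` having the same inner
product `K` with a nonzero vector `x` of that plane are mirror images in the line through `x`. -/
theorem add_eq_smul_of_inner_eq {n x y y' : Euc 3} (hn : n ≠ 0) (hx : x ≠ 0)
    (hnx : inner ℝ n x = 0) (hny : inner ℝ n y = 0) (hny' : inner ℝ n y' = 0) (hne : y ≠ y')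
    {K : ℝ} (hxy : inner ℝ x y = K) (hxy' : inner ℝ x y' = K)
    (hnorm : inner ℝ y y = inner ℝ y' y') :
    y + y' = (2 * K / inner ℝ x x) • x := by
  set e := y - y' with he
  have hne' : e ≠ 0 := sub_ne_zero.2 hne
  have hnd : inner ℝ n e = 0 := by rw [he, inner_sub_right, hny, hny', sub_zero]
  have hli : LinearIndependent ℝ ![n, e] := by
    apply linearIndependent_of_ne_zero_of_inner_eq_zero
    · intro i; fin_cases i <;> simpa
    · intro i j hij
      fin_cases i <;> fin_cases j <;> simp_all [real_inner_comm]
  have hrank : Module.finrank ℝ (Submodule.span ℝ (Set.range ![n, e]))ᗮ = 1 := by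
    apply Submodule.finrank_add_finrank_orthogonal'
    rw [finrank_span_eq_card hli]; simp
  have hmem : ∀ z : Euc 3, inner ℝ n z = 0 → inner ℝ e z = 0 →
      z ∈ (Submodule.span ℝ (Set.range ![n, e]))ᗮ := by
    intro z h1 h2
    rw [Submodule.mem_orthogonal]
    intro u hu
    induction hu using Submodule.span_induction with
    | mem u hu => obtain ⟨i, rfl⟩ := hu; fin_cases i <;> simpa
    | zero => simp
    | add a b _ _ ha hb => rw [inner_add_left, ha, hb, add_zero]
    | smul a b _ hb => rw [real_inner_smul_left, hb, mul_zero]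
  have hxm := hmem x hnx (by rw [he, inner_sub_left, real_inner_comm, hxy, real_inner_comm, hxy',
    sub_self])
  have hsm := hmem (y + y') (by rw [inner_add_right, hny, hny', add_zero]) (by
    rw [he, inner_sub_left, inner_add_right, inner_add_right, real_inner_comm y y', hnorm]; ring)
  obtain ⟨c, hc⟩ := exists_smul_eq_of_finrank_eq_one hrank (x := ⟨x, hxm⟩) (by simpa using hx)
    ⟨y + y', hsm⟩
  have hc : c • x = y + y' := congrArg Subtype.val hc
  have hxx : inner ℝ x x ≠ 0 := by simpa using hx
  have : inner ℝ x (y + y') = c * inner ℝ x x := by rw [← hc, real_inner_smul_right]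
  rw [inner_add_right, hxy, hxy'] at this
  rw [← hc]
  congr 1
  field_simp
  linarith

/-- At a vertex `x` of a planar face of a polytope, whose neighbours in the face all have the same
distance from a point `o` and the same inner product with `x` (relative to `o`), there are exactly
two neighbours, which are mirror images of each other, and the face lies in the angle they span. -/
theorem IsPolytope.exists_reflected_neighbor {P : Set (Euc 3)} (hP : IsPolytope P)
    {n o : Euc 3} (hn : n ≠ 0) {M : ℝ} (hM : ∀ z ∈ P, inner ℝ n z ≤ M) (ho : inner ℝ n o = M)
    {x y : Euc 3} (hx : x ∈ P.extremePoints ℝ) (hnx : inner ℝ n x = M) (hxo : x - o ≠ 0)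
    (hxy : IsEdge P x y) (hny : inner ℝ n y = M) {K q : ℝ}
    (hK : ∀ z, IsEdge P x z → inner ℝ n z = M →
      inner ℝ (x - o) (z - o) = K ∧ inner ℝ (z - o) (z - o) = q)
    {u : Euc 3} (hu : u ∈ P) (hnu : inner ℝ n u = M) (hux : ∀ κ : ℝ, u - x ≠ κ • (y - x)) :
    ∃ y', y' ≠ y ∧ IsEdge P x y' ∧ inner ℝ n y' = M ∧
      (y - o) + (y' - o) = (2 * K / inner ℝ (x - o) (x - o)) • (x - o) ∧
      ∀ z ∈ P, inner ℝ n z = M → ∃ α β : ℝ, 0 ≤ α ∧ 0 ≤ β ∧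
        z - x = α • (y - x) + β • (y' - x) := by
  have hcone : ∀ z ∈ P, inner ℝ n z = M →
      z - x ∈ Submodule.span ℝ≥0 {d | IsEdge P x (x + d) ∧ inner ℝ n (x + d) = M} :=
    fun z hz hnz => hP.sub_mem_span_edges_of_face (f := innerₗ (Euc 3) n) hM hx hnx hz hnz
  have hrefl : ∀ z, z ≠ y → IsEdge P x z → inner ℝ n z = M →
      (y - o) + (z - o) = (2 * K / inner ℝ (x - o) (x - o)) • (x - o) := by
    intro z hzy hxz hnz
    refine add_eq_smul_of_inner_eq hn hxo ?_ ?_ ?_ ?_ (hK y hxy hny).1 (hK z hxz hnz).1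
      ((hK y hxy hny).2.trans (hK z hxz hnz).2.symm)
    · rw [inner_sub_right, hnx, ho, sub_self]
    · rw [inner_sub_right, hny, ho, sub_self]
    · rw [inner_sub_right, hnz, ho, sub_self]
    · simpa using hzy.symm
  obtain ⟨y', hy'y, hxy', hny'⟩ : ∃ y', y' ≠ y ∧ IsEdge P x y' ∧ inner ℝ n y' = M := by
    by_contra! hcon
    have h := Submodule.span_mono (t := {y - x}) ?_ (hcone u hu hnu)
    · obtain ⟨κ, hκ⟩ := Submodule.mem_span_singleton.1 h
      exact hux κ hκ.symm
    · rintro e ⟨he, hne⟩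
      by_contra hey
      refine hcon (x + e) ?_ he hne
      rintro rfl
      exact hey (by simp)
  refine ⟨y', hy'y, hxy', hny', hrefl y' hy'y hxy' hny', fun z hz hnz => ?_⟩
  have h := Submodule.span_mono (t := {y - x, y' - x}) ?_ (hcone z hz hnz)
  · obtain ⟨α, β, h⟩ := Submodule.mem_span_pair.1 h
    exact ⟨α, β, α.2, β.2, h.symm⟩
  · rintro e ⟨he, hne⟩
    by_cases hey : x + e = y
    · left; rw [← hey]; simp
    · right
      have h1 := hrefl _ hey he hne
      rw [← hrefl y' hy'y hxy' hny'] at h1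
      have : x + e = y' := by simpa using h1
      rw [mem_singleton_iff, ← this]; simp

/-- In a strictly bipartite polyhedron, the angle of a face at an inner vertex is at least `π/2`. -/
theorem IsBipartiteWith.inner_sub_sub_nonpos {P V1 V2 : Set (Euc 3)} {r1 r2 ℓ : ℝ}
    (hP : IsPolytope P) (hbip : IsBipartiteWith P V1 V2 r1 r2 ℓ) (hstrict : r1 < r2)
    {n : Euc 3} (hn : n ≠ 0) {M : ℝ} (hM : ∀ z ∈ P, inner ℝ n z ≤ M)
    {v w w' : Euc 3} (hv : v ∈ V1) (hnv : inner ℝ n v = M)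
    (hvw : IsEdge P v w) (hnw : inner ℝ n w = M) (hvw' : IsEdge P v w') (hnw' : inner ℝ n w' = M)
    (hcol : ∀ κ : ℝ, w' - v ≠ κ • (w - v)) :
    inner ℝ (w - v) (w' - v) ≤ 0 := by
  obtain ⟨hℓ, hlen, hV, hdisj, hedge, hr1, -, hn1, hn2⟩ := hbip
  have hext : ∀ {x}, x ∈ V1 ∨ x ∈ V2 → x ∈ P.extremePoints ℝ := fun h => by rwa [← hV]
  have hnb1 : ∀ {x y}, x ∈ V1 → IsEdge P x y → y ∈ V2 := fun hx h =>
    (hedge _ _ h).elim And.right fun h' => absurd h'.1 (Set.disjoint_left.1 hdisj hx)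
  have hnb2 : ∀ {x y}, x ∈ V2 → IsEdge P x y → y ∈ V1 := fun hx h =>
    (hedge _ _ h).elim (fun h' => absurd hx (Set.disjoint_left.1 hdisj h'.1)) And.right
  have hsymm : ∀ {x y}, IsEdge P x y → IsEdge P y x := fun h =>
    ⟨h.1.symm, by rw [segment_symm]; exact h.2⟩
  -- the foot of the perpendicular from the origin to the plane of the face
  obtain ⟨o, ho, hoz⟩ : ∃ o : Euc 3, inner ℝ n o = M ∧
      ∀ z, inner ℝ n z = M → inner ℝ o z = inner ℝ o o := by
    refine ⟨(M / inner ℝ n n) • n, ?_, fun z hz => ?_⟩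
    · rw [real_inner_smul_right]; field_simp
    · rw [real_inner_smul_left, real_inner_smul_left, real_inner_smul_right, hz]; field_simp
  have hin : ∀ x y, inner ℝ n x = M → inner ℝ n y = M →
      inner ℝ (x - o) (y - o) = inner ℝ x y - inner ℝ o o := by
    intro x y hx hy
    rw [inner_sub_left, inner_sub_right, inner_sub_right, real_inner_comm o x, hoz x hx, hoz y hy]
    ring
  obtain ⟨p, hp⟩ : ∃ p, p = r1 ^ 2 - inner ℝ o o := ⟨_, rfl⟩
  obtain ⟨q, hq⟩ : ∃ q, q = r2 ^ 2 - inner ℝ o o := ⟨_, rfl⟩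
  obtain ⟨K, hK⟩ : ∃ K, K = (p + q - ℓ ^ 2) / 2 := ⟨_, rfl⟩
  have hpV : ∀ {x}, x ∈ V1 → inner ℝ n x = M → inner ℝ (x - o) (x - o) = p := by
    intro x hx hnx
    rw [hin x x hnx hnx, real_inner_self_eq_norm_sq, hn1 x hx, hp]
  have hqV : ∀ {x}, x ∈ V2 → inner ℝ n x = M → inner ℝ (x - o) (x - o) = q := by
    intro x hx hnx
    rw [hin x x hnx hnx, real_inner_self_eq_norm_sq, hn2 x hx, hq]
  have hKV : ∀ {x y}, x ∈ V1 → y ∈ V2 → IsEdge P x y → inner ℝ n x = M → inner ℝ n y = M →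
      inner ℝ (x - o) (y - o) = K := by
    intro x y hx hy hxy hnx hny
    have h1 := hlen x y hxy
    have h2 : inner ℝ (x - y) (x - y) = ℓ ^ 2 := by rw [real_inner_self_eq_norm_sq, h1]
    rw [inner_sub_left, inner_sub_right, inner_sub_right, real_inner_comm x y,
      real_inner_self_eq_norm_sq, real_inner_self_eq_norm_sq, hn1 x hx, hn2 y hy] at h2
    rw [hin x y hnx hny, hK, hp, hq]
    linarith
  have hpq : p < q := by rw [hp, hq]; nlinarith
  have hw := hnb1 hv hvw
  have hw' := hnb1 hv hvw'
  have hp0 : 0 ≤ p := hpV hv hnv ▸ real_inner_self_nonneg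
  have hq0 : 0 < q := hp0.trans_lt hpq
  have hKq : K < q := by rw [hK]; nlinarith
  have hmem : ∀ {x y}, IsEdge P x y → y ∈ P := fun h => h.2.subset (right_mem_segment ℝ _ _)
  have hne1 : ∀ {x}, x ∈ V2 → inner ℝ n x = M → x - o ≠ 0 := by
    intro x hx hnx h
    have := hqV hx hnx
    rw [h, inner_zero_left] at this
    exact hq0.ne this
  -- the second neighbour of `w` in the face
  obtain ⟨v₂, hv₂ne, hwv₂, hnv₂, hv₂, hconew⟩ := hP.exists_reflected_neighbor hn hM ho
    (hext (Or.inr hw)) hnw (hne1 hw hnw) (hsymm hvw) hnv (K := K) (q := p)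
    (fun z hz hnz => ⟨by
      rw [real_inner_comm]; exact hKV (hnb2 hw hz) hw (hsymm hz) hnz hnw, hpV (hnb2 hw hz) hnz⟩)
    (hmem hvw') hnw' (by
      intro κ h
      apply hcol (1 - κ)
      rw [← sub_add_sub_cancel w' w v, h]; module)
  rw [hqV hw hnw] at hv₂
  have hv₂V := hnb2 hw hwv₂
  have hpne : p ≠ 0 := by
    intro h0
    have h1 := hpV hv hnv
    have h2 := hpV hv₂V hnv₂
    rw [h0, inner_self_eq_zero, sub_eq_zero] at h1 h2
    exact hv₂ne (h2.trans h1.symm)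
  have hp0 : 0 < p := lt_of_le_of_ne hp0 hpne.symm
  have hne2 : ∀ {x}, x ∈ V1 → inner ℝ n x = M → x - o ≠ 0 := by
    intro x hx hnx h
    have := hpV hx hnx
    rw [h, inner_zero_left] at this
    exact hp0.ne this
  have hKV1 : ∀ {x}, x ∈ V1 → inner ℝ n x = M → ∀ z, IsEdge P x z → inner ℝ n z = M →
      inner ℝ (x - o) (z - o) = K ∧ inner ℝ (z - o) (z - o) = q := fun hx hnx z hz hnz =>
    ⟨hKV hx (hnb1 hx hz) hz hnx hnz, hqV (hnb1 hx hz) hnz⟩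
  -- the two neighbours of `v` in the face
  obtain ⟨w₁, hw₁ne, hvw₁, hnw₁, hw₁, hconev⟩ := hP.exists_reflected_neighbor hn hM ho
    (hext (Or.inl hv)) hnv (hne2 hv hnv) hvw hnw (hKV1 hv hnv) (hmem hvw') hnw' hcol
  rw [hpV hv hnv] at hw₁
  have hww' : w' ≠ w := by
    rintro rfl
    exact hcol 1 (by simp)
  have hw₁' : (w - o) + (w' - o) = (2 * K / p) • (v - o) := by
    rw [← hpV hv hnv]
    refine add_eq_smul_of_inner_eq hn (hne2 hv hnv) ?_ ?_ ?_ ?_ (hKV1 hv hnv w hvw hnw).1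
      (hKV1 hv hnv w' hvw' hnw').1 ((hqV hw hnw).trans (hqV hw' hnw').symm)
    · rw [inner_sub_right, hnv, ho, sub_self]
    · rw [inner_sub_right, hnw, ho, sub_self]
    · rw [inner_sub_right, hnw', ho, sub_self]
    · simpa using hww'.symm
  obtain rfl : w' = w₁ := by
    have := hw₁'.trans hw₁.symm
    simpa using this
  -- relative coordinates
  have hind : ∀ s t : ℝ, s • (v - o) + t • (w - o) = 0 → s = 0 ∧ t = 0 := by
    intro s t h
    by_cases ht : t = 0
    · subst ht
      rw [zero_smul, add_zero, smul_eq_zero] at h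
      exact ⟨h.resolve_right (hne2 hv hnv), rfl⟩
    · exfalso
      have h1 : w - o = (-s / t) • (v - o) := by
        have : t • (w - o) = (-s) • (v - o) := by rw [← sub_eq_zero, ← h]; module
        rw [div_eq_inv_mul, mul_smul, ← this, inv_smul_smul₀ ht]
      have h2 : K = (-s / t) * p := by
        rw [← (hKV1 hv hnv w hvw hnw).1, h1, real_inner_smul_right, hpV hv hnv]
      have h3 : 2 * K / p = 2 * (-s / t) := by rw [h2]; field_simp
      apply hww'
      rw [h3, two_mul, add_smul, ← h1] at hw₁
      simpa using hw₁
  obtain ⟨a, ha⟩ : ∃ a, a = 2 * K / p := ⟨_, rfl⟩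
  obtain ⟨b, hb⟩ : ∃ b, b = 2 * K / q := ⟨_, rfl⟩
  rw [← ha] at hw₁
  rw [← hb] at hv₂
  have hb2 : b < 2 := by rw [hb, div_lt_iff₀ hq0]; linarith
  have hap : a * p = 2 * K := by rw [ha]; field_simp
  have hbq : b * q = 2 * K := by rw [hb]; field_simp
  have hw'e : w' = o + (a • (v - o) - (w - o)) := by rw [← hw₁]; abel
  have hv₂e : v₂ = o + (b • (w - o) - (v - o)) := by rw [← hv₂]; abel
  -- the second neighbour of `v₂` in the face
  obtain ⟨w₂, -, hvw₂, hnw₂, hw₂, -⟩ := hP.exists_reflected_neighbor hn hM ho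
    (hext (Or.inl hv₂V)) hnv₂ (hne2 hv₂V hnv₂) (hsymm hwv₂) hnw (hKV1 hv₂V hnv₂)
    (hext (Or.inl hv)).1 hnv (by
      intro κ h
      have := hind (2 - κ) (-b - κ * (1 - b)) (by
        rw [hv₂e, ← sub_eq_zero] at h
        rw [← h]; module)
      obtain ⟨h1, h2⟩ := this
      obtain rfl : κ = 2 := by linarith
      linarith)
  rw [hpV hv₂V hnv₂, ← ha] at hw₂
  have hw₂e : w₂ = o + ((a * b - 1) • (w - o) - a • (v - o)) := by
    have : w₂ = o + (a • (v₂ - o) - (w - o)) := by rw [← hw₂]; abel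
    rw [this, hv₂e]; module
  by_contra! hacute
  -- the half-planes bounded by the edges, tested at suitable vertices
  have ha2 : a ≤ 2 := by
    obtain ⟨α, β, hα, hβ, h⟩ := hconew w' (hmem hvw') hnw'
    obtain ⟨h1, h2⟩ := hind (a - (α - β)) (-1 - (1 - α + β * (b - 1))) (by
      rw [hv₂e, hw'e, ← sub_eq_zero] at h
      rw [← h]; module)
    nlinarith
  have hKneg : K < 0 := by
    have h : inner ℝ (w - v) (w' - v) = (a - 2) * K - q + p := by
      have e1 : w - v = (w - o) - (v - o) := by abel
      have e2 : w' - v = (a - 1) • (v - o) - (w - o) := by rw [hw'e]; module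
      have e3 : ∀ x y : Euc 3, inner ℝ (y - x) ((a - 1) • x - y) =
          a * inner ℝ x y - inner ℝ y y - (a - 1) * inner ℝ x x := by
        intro x y
        simp only [inner_sub_left, inner_sub_right, real_inner_smul_right, real_inner_comm x y]
        ring
      rw [e1, e2, e3, hpV hv hnv, hqV hw hnw, hKV hv hw hvw hnv hnw]
      linear_combination -hap
    rw [h] at hacute
    by_contra! h0
    nlinarith
  have ha0 : a < 0 := by rw [ha]; exact div_neg_of_neg_of_pos (by linarith) hp0
  have hab1 : 2 + b ≤ a * b := by
    obtain ⟨α, β, hα, hβ, h⟩ := hconev w₂ (hmem hvw₂) hnw₂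
    obtain ⟨h1, h2⟩ := hind (-a - (1 - α + β * (a - 1))) (a * b - 1 - (α - β)) (by
      rw [hw₂e, hw'e, ← sub_eq_zero] at h
      rw [← h]; module)
    have h3 : α * (2 - a) = a * (2 - a * b + b) := by
      obtain rfl : β = α - a * b + 1 := by linarith
      linarith
    have : 0 ≤ a * (2 - a * b + b) := h3 ▸ mul_nonneg hα (by linarith)
    nlinarith
  have hab2 : a * b ≤ 2 + a := by
    obtain ⟨α, β, hα, hβ, h⟩ := hconew w' (hmem hvw') hnw'
    obtain ⟨h1, h2⟩ := hind (a - (α - β)) (-1 - (1 - α + β * (b - 1))) (by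
      rw [hv₂e, hw'e, ← sub_eq_zero] at h
      rw [← h]; module)
    have h3 : α * (2 - b) = 2 + a - a * b := by
      obtain rfl : β = α - a := by linarith
      linarith
    have : 0 ≤ 2 + a - a * b := h3 ▸ mul_nonneg hα (by linarith)
    linarith
  nlinarith

/-- In a full-dimensional strictly bipartite polyhedron `P ⊆ ℝ³` with
radii `r1 < r2`, every vertex of the inner partition class `V1` is contained in exactly
three edges of `P`. -/
theorem inner_vertex_degree_three
    (P V1 V2 : Set (Euc 3)) (r1 r2 ℓ : ℝ)
    (hP : IsPolytope P) (hfull : FullDim P)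
    (hbip : IsBipartiteWith P V1 V2 r1 r2 ℓ) (hstrict : r1 < r2)
    (v : Euc 3) (hv : v ∈ V1) :
    {e : Set (Euc 3) | IsEdgeSet P e ∧ v ∈ e}.ncard = 3 := by
  classical
  have hbip' := hbip
  obtain ⟨hℓ, hlen, hV, hdisj, hedge, hr1, -, hn1, hn2⟩ := hbip'
  have hvP : v ∈ P.extremePoints ℝ := by rw [← hV]; exact Or.inl hv
  have hmem : ∀ {x y}, IsEdge P x y → y ∈ P := fun h => h.2.subset (right_mem_segment ℝ _ _)
  have hnb : ∀ {w}, IsEdge P v w → w ∈ V2 := fun h =>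
    (hedge _ _ h).elim And.right fun h' => absurd h'.1 (Set.disjoint_left.1 hdisj hv)
  have hfin : {w | IsEdge P v w}.Finite := by
    obtain ⟨S, hS⟩ := hP
    refine S.finite_toSet.subset fun w hw => ?_
    have : w ∈ P.extremePoints ℝ := by rw [← hV]; exact Or.inr (hnb hw)
    rw [hS] at this
    exact extremePoints_convexHull_subset this
  -- edges through `v` correspond to neighbours of `v`
  have himage : {e : Set (Euc 3) | IsEdgeSet P e ∧ v ∈ e} = segment ℝ v '' {w | IsEdge P v w} := by
    ext e
    constructor
    · rintro ⟨⟨x, y, hxy, rfl⟩, hve⟩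
      rcases (mem_extremePoints_iff_forall_segment.1 hvP).2 x (hxy.2.subset
        (left_mem_segment ℝ _ _)) y (hmem hxy) hve with rfl | rfl
      · exact ⟨y, hxy, rfl⟩
      · refine ⟨x, ⟨hxy.1.symm, ?_⟩, segment_symm ℝ _ _⟩
        rw [segment_symm]; exact hxy.2
    · rintro ⟨w, hw, rfl⟩
      exact ⟨⟨v, w, hw, rfl⟩, left_mem_segment ℝ _ _⟩
  have hinj : Set.InjOn (segment ℝ v) {w | IsEdge P v w} := by
    intro w hw w' hw' h
    have hwP : w ∈ P.extremePoints ℝ := by rw [← hV]; exact Or.inr (hnb hw)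
    have hmw : w ∈ segment ℝ v w' := h ▸ right_mem_segment ℝ _ _
    rcases (mem_extremePoints_iff_forall_segment.1 hwP).2 v hvP.1 w' (hmem hw') hmw with h | h
    · exact absurd h hw.1
    · exact h.symm
  rw [himage, hinj.ncard_image, Set.ncard_eq_toFinset_card _ hfin]
  set N := hfin.toFinset with hN
  have hNmem : ∀ {w}, w ∈ N ↔ IsEdge P v w := by simp [hN]
  -- the neighbours of `v` lie on a circle in a plane orthogonal to `v`
  obtain ⟨c, hc⟩ : ∃ c, c = (r2 ^ 2 - r1 ^ 2 - ℓ ^ 2) / 2 := ⟨_, rfl⟩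
  have huu : ∀ {w}, w ∈ N → inner ℝ (w - v) (w - v) = ℓ ^ 2 := by
    intro w hw
    rw [real_inner_self_eq_norm_sq, norm_sub_rev, hlen v w (hNmem.1 hw)]
  have hvu : ∀ {w}, w ∈ N → inner ℝ v (w - v) = c := by
    intro w hw
    have h1 := huu hw
    have h2 : inner ℝ w w = r2 ^ 2 := by
      rw [real_inner_self_eq_norm_sq, hn2 w (hnb (hNmem.1 hw))]
    have h3 : inner ℝ v v = r1 ^ 2 := by rw [real_inner_self_eq_norm_sq, hn1 v hv]
    rw [inner_sub_left, inner_sub_right, inner_sub_right, real_inner_comm v w, h2, h3] at h1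
    rw [inner_sub_right, h3, hc]
    linarith
  have hspan : Submodule.span ℝ ((N.image (· - v) : Finset (Euc 3)) : Set (Euc 3)) = ⊤ := by
    rw [eq_top_iff, ← AffineSubspace.direction_top ℝ (Euc 3) (Euc 3), ← hfull,
      direction_affineSpan, vectorSpan_eq_span_vsub_set_right ℝ hvP.1, Submodule.span_le]
    rintro _ ⟨y, hy, rfl⟩
    refine Submodule.span_mono (R := ℝ) ?_
      (Submodule.span_le_restrictScalars ℝ≥0 ℝ _ (hP.sub_mem_span_edges hvP hy))
    intro e he
    rw [Finset.coe_image]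
    exact ⟨v + e, hNmem.2 he, add_sub_cancel_left v e⟩
  have hc0 : c ≠ 0 := by
    rintro h0
    have h1 : ∀ z ∈ Submodule.span ℝ ((N.image (· - v) : Finset (Euc 3)) : Set (Euc 3)),
        inner ℝ v z = 0 := by
      intro z hz
      induction hz using Submodule.span_induction with
      | mem z hz =>
        rw [Finset.coe_image] at hz
        obtain ⟨w, hw, rfl⟩ := hz
        exact (hvu hw).trans h0
      | zero => simp
      | add a b _ _ ha hb => rw [inner_add_right, ha, hb, add_zero]
      | smul a b _ hb => rw [real_inner_smul_right, hb, mul_zero]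
    have h2 := h1 v (hspan ▸ Submodule.mem_top)
    rw [real_inner_self_eq_norm_sq, hn1 v hv] at h2
    exact hr1.ne' (by simpa using h2)
  have hge : 3 ≤ N.card := by
    have h := finrank_span_finset_le_card (R := ℝ) (N.image (· - v))
    rw [Set.finrank, hspan, finrank_top, finrank_euclideanSpace_fin] at h
    exact h.trans Finset.card_image_le
  refine le_antisymm ?_ hge
  -- it suffices that no two edges at `v` form an acute angle
  suffices hobt : ∀ w ∈ N, ∀ w' ∈ N, w ≠ w' → inner ℝ (w - v) (w' - v) ≤ 0 by
    have hli : LinearIndependent ℝ (fun w : N => (w : Euc 3) - v) := by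
      refine LinearMap.BilinForm.linearIndependent_of_pairwise_le_zero (innerₗ (Euc 3)) ?_
        (c⁻¹ • innerₗ (Euc 3) v) _ ?_ ?_
      · intro x hx
        exact real_inner_self_pos.2 hx
      · intro w
        simp [hvu w.2, hc0]
      · intro w w' hne
        exact hobt w w.2 w' w'.2 (Subtype.coe_ne_coe.2 hne)
    simpa using hli.fintype_card_le_finrank
  by_contra! hcon
  obtain ⟨y, hy, y', hy', hyy', hpos⟩ := hcon
  -- choose the pair of neighbours with the smallest angle
  obtain ⟨⟨w, w'⟩, hww, hmax⟩ := N.offDiag.exists_max_image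
    (fun x => inner ℝ (x.1 - v) (x.2 - v)) ⟨(y, y'), by simp [hy, hy', hyy']⟩
  obtain ⟨hw, hw', hne⟩ := Finset.mem_offDiag.1 hww
  dsimp only at hw hw' hne
  obtain ⟨m, hm⟩ : ∃ m, m = inner ℝ (w - v) (w' - v) := ⟨_, rfl⟩
  have hmle : ∀ x ∈ N, ∀ x' ∈ N, x ≠ x' → inner ℝ (x - v) (x' - v) ≤ m := fun x hx x' hx' h =>
    hm ▸ hmax (x, x') (by simp [hx, hx', h])
  have hm0 : 0 < m := hpos.trans_le (hmle y hy y' hy' hyy')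
  have hmℓ : m < ℓ ^ 2 := by
    have h : 0 < inner ℝ ((w - v) - (w' - v)) ((w - v) - (w' - v)) := by
      rw [real_inner_self_pos, sub_sub_sub_cancel_right]
      exact sub_ne_zero.2 hne
    rw [real_inner_sub_sub_self, huu hw, huu hw', ← hm] at h
    linarith
  -- the normal vector of the face spanned by this pair
  set n : Euc 3 := (w - v) + (w' - v) - ((ℓ ^ 2 + m) / c) • v with hn
  have hnx : ∀ x ∈ N, inner ℝ n (x - v) =
      inner ℝ (w - v) (x - v) + inner ℝ (w' - v) (x - v) - (ℓ ^ 2 + m) := by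
    intro x hx
    rw [hn, inner_sub_left, inner_add_left, real_inner_smul_left, hvu hx, div_mul_cancel₀ _ hc0]
  have hnw : inner ℝ n (w - v) = 0 := by
    rw [hnx w hw, huu hw, real_inner_comm (w - v) (w' - v), ← hm]; ring
  have hnw' : inner ℝ n (w' - v) = 0 := by
    rw [hnx w' hw', huu hw', ← hm]; ring
  have hnlt : ∀ x ∈ N, x ≠ w → x ≠ w' → inner ℝ n (x - v) < 0 := by
    intro x hx h1 h2
    rw [hnx x hx]
    linarith [hmle w hw x hx h1.symm, hmle w' hw' x hx h2.symm]
  have hn0 : n ≠ 0 := by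
    intro h0
    obtain ⟨x, hx, hx'⟩ := Finset.exists_mem_notMem_of_card_lt_card
      (show ({w, w'} : Finset (Euc 3)).card < N.card from Finset.card_le_two.trans_lt hge)
    have := hnlt x hx (by rintro rfl; simp at hx') (by rintro rfl; simp at hx')
    rw [h0, inner_zero_left] at this
    exact lt_irrefl _ this
  have hM : ∀ z ∈ P, inner ℝ n z ≤ inner ℝ n v := by
    intro z hz
    have hle : ∀ e ∈ Submodule.span ℝ≥0 {e | IsEdge P v (v + e)}, inner ℝ n e ≤ 0 := by
      intro e he
      induction he using Submodule.span_induction with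
      | mem e he =>
        have hx : v + e ∈ N := hNmem.2 he
        rw [← add_sub_cancel_left v e]
        by_cases h1 : v + e = w
        · rw [h1, hnw]
        by_cases h2 : v + e = w'
        · rw [h2, hnw']
        exact (hnlt _ hx h1 h2).le
      | zero => simp
      | add a b _ _ ha hb => rw [inner_add_right]; linarith
      | smul a b _ hb =>
        change inner ℝ n ((a : ℝ) • b) ≤ 0
        rw [real_inner_smul_right]
        exact mul_nonpos_of_nonneg_of_nonpos a.2 hb
    have := hle _ (hP.sub_mem_span_edges hvP hz)
    rw [inner_sub_right] at this
    linarith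
  have hfinal := hbip.inner_sub_sub_nonpos hP hstrict hn0 hM hv rfl (hNmem.1 hw)
    (by rw [inner_sub_right] at hnw; linarith) (hNmem.1 hw')
    (by rw [inner_sub_right] at hnw'; linarith) (by
      intro κ h
      have h1 := hvu hw'
      rw [h, real_inner_smul_right, hvu hw] at h1
      obtain rfl : κ = 1 := mul_right_cancel₀ hc0 (h1.trans (one_mul c).symm)
      rw [one_smul] at h
      exact hne (sub_left_injective h).symm)
  rw [← hm] at hfinal
  exact absurd hm0 (not_lt.2 hfinal)
end
end
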